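/- Let k ≥ 2 be an integer. There exist a constant C ≥ 1 and a natural number t, depending only on k, such that the following holds. Let α : G^k → 𝔽₂ be a multilinear form with prank(α + α∘(1 2)) ≤ r. Then there exists a multilinear form α' : G^k → 𝔽₂ which is symmetric in its first two variables and satisfies prank(α + α') ≤ exp^{(t)}(C · r). -/

import Mathlib

open Finset

/-- `β : (Fin k → V) → ZMod 2` is a multilinear form in the variables indexed by `S`:
it depends only on the coordinates in `S` and is additive (hence `𝔽₂`-linear) in each of
those coordinates. -/
def MultilinearOn {V : Type*} [AddCommGroup V] [Module (ZMod 2) V] (k : ℕ)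
    (S : Finset (Fin k)) (β : (Fin k → V) → ZMod 2) : Prop :=
  (∀ x y : Fin k → V, (∀ i ∈ S, x i = y i) → β x = β y) ∧
  (∀ i ∈ S, ∀ (x : Fin k → V) (u v : V),
    β (Function.update x i (u + v)) = β (Function.update x i u) + β (Function.update x i v))

/-- A multilinear form in all `k` variables. -/
def IsMultilinear {V : Type*} [AddCommGroup V] [Module (ZMod 2) V] (k : ℕ)
    (α : (Fin k → V) → ZMod 2) : Prop :=
  MultilinearOn k Finset.univ α

/-- `α`, a multilinear form in the variables indexed by `S`, admits a partition-rank
decomposition with `m` terms. -/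
def PrankDecompOn {V : Type*} [AddCommGroup V] [Module (ZMod 2) V] (k : ℕ)
    (S : Finset (Fin k)) (m : ℕ) (α : (Fin k → V) → ZMod 2) : Prop :=
  ∃ (I : Fin m → Finset (Fin k)) (β γ : Fin m → ((Fin k → V) → ZMod 2)),
    (∀ i, I i ⊆ S) ∧ (∀ i, I i ≠ ∅) ∧ (∀ i, I i ≠ S) ∧
    (∀ i, MultilinearOn k (I i) (β i)) ∧
    (∀ i, MultilinearOn k (S \ I i) (γ i)) ∧
    (∀ x, α x = ∑ i, β i x * γ i x)

/-- The partition rank of a multilinear form in the variables indexed by `S`. -/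
noncomputable def prankOn {V : Type*} [AddCommGroup V] [Module (ZMod 2) V] (k : ℕ)
    (S : Finset (Fin k)) (α : (Fin k → V) → ZMod 2) : ℕ :=
  sInf {m | PrankDecompOn k S m α}

/-- The partition rank of a multilinear form in `k` variables. -/
noncomputable def prank {V : Type*} [AddCommGroup V] [Module (ZMod 2) V] (k : ℕ)
    (α : (Fin k → V) → ZMod 2) : ℕ :=
  prankOn k Finset.univ α

/-- `α ∘ π`: the form `(x₁, …, x_k) ↦ α(x_{π⁻¹(1)}, …, x_{π⁻¹(k)})`. -/
def permForm {V : Type*} (k : ℕ) (π : Equiv.Perm (Fin k))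
    (α : (Fin k → V) → ZMod 2) : (Fin k → V) → ZMod 2 :=
  fun x => α (fun i => x (π.symm i))

/-- `α` is symmetric in its first `m` variables (0-indexed: coordinates `< m`). -/
def SymmetricInFirst {V : Type*} (k m : ℕ) (α : (Fin k → V) → ZMod 2) : Prop :=
  ∀ i j : Fin k, (i : ℕ) < m → (j : ℕ) < m → permForm k (Equiv.swap i j) α = α

/-- `α` is symmetric in all of its variables. -/
def SymmetricForm {V : Type*} (k : ℕ) (α : (Fin k → V) → ZMod 2) : Prop :=
  ∀ π : Equiv.Perm (Fin k), permForm k π α = α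

/-- `σ` is strongly symmetric: it is symmetric, and the form
`(x, y₃, …, y_k) ↦ σ(x, x, y₃, …, y_k)` is also symmetric.  (Given the symmetry of `σ`,
the latter is equivalent to being allowed to swap the doubled variable with the third
variable, which is how it is stated here.) -/
def StronglySymmetric {V : Type*} (k : ℕ) (σ : (Fin k → V) → ZMod 2) : Prop :=
  SymmetricForm k σ ∧
  ∀ (u v : V) (z : Fin k → V),
    σ (fun i => if (i : ℕ) = 0 ∨ (i : ℕ) = 1 then u else if (i : ℕ) = 2 then v else z i) =
    σ (fun i => if (i : ℕ) = 0 ∨ (i : ℕ) = 1 then v else if (i : ℕ) = 2 then u else z i)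

section MultilinearOnSubset

variable {k : ℕ} {V M : Type*} [AddCommGroup V]

/-- A function of `k` vectors which depends only on the coordinates in `S` and is additive in each
of them, with values in an arbitrary additive monoid. -/
def AdditiveOn [AddCommMonoid M] (S : Finset (Fin k)) (f : (Fin k → V) → M) : Prop :=
  (∀ x y : Fin k → V, (∀ i ∈ S, x i = y i) → f x = f y) ∧
  (∀ i ∈ S, ∀ (x : Fin k → V) (u v : V),
    f (Function.update x i (u + v)) = f (Function.update x i u) + f (Function.update x i v))

namespace AdditiveOn

variable {S T : Finset (Fin k)}

theorem zero [AddCommMonoid M] : AdditiveOn S (fun _ : Fin k → V => (0 : M)) :=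
  ⟨fun _ _ _ => rfl, fun _ _ _ _ _ => (add_zero 0).symm⟩

theorem const [AddCommMonoid M] (c : M) : AdditiveOn ∅ (fun _ : Fin k → V => c) :=
  ⟨fun _ _ _ => rfl, fun _ h => absurd h (notMem_empty _)⟩

theorem add [AddCommMonoid M] {f g : (Fin k → V) → M} (hf : AdditiveOn S f)
    (hg : AdditiveOn S g) : AdditiveOn S (fun x => f x + g x) :=
  ⟨fun x y h => by simp only [hf.1 x y h, hg.1 x y h],
   fun i hi x u v => by simp only [hf.2 i hi, hg.2 i hi]; abel⟩

theorem sum [AddCommMonoid M] {ι : Type*} (s : Finset ι) {f : ι → (Fin k → V) → M}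
    (hf : ∀ a ∈ s, AdditiveOn S (f a)) : AdditiveOn S (fun x => ∑ a ∈ s, f a x) :=
  ⟨fun x y h => sum_congr rfl fun a ha => (hf a ha).1 x y h,
   fun i hi x u v => by
    rw [← sum_add_distrib]; exact sum_congr rfl fun a ha => (hf a ha).2 i hi x u v⟩

theorem comp_addHom {M' : Type*} [AddCommMonoid M] [AddCommMonoid M'] {f : (Fin k → V) → M}
    (hf : AdditiveOn S f) (φ : M →+ M') : AdditiveOn S (fun x => φ (f x)) :=
  ⟨fun x y h => by simp only [hf.1 x y h], fun i hi x u v => by simp only [hf.2 i hi, map_add]⟩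

theorem update_of_notMem [AddCommMonoid M] {f : (Fin k → V) → M} (hf : AdditiveOn S f) {i : Fin k}
    (hi : i ∉ S) (x : Fin k → V) (u : V) : f (Function.update x i u) = f x :=
  hf.1 _ _ fun j hj => Function.update_of_ne (by rintro rfl; exact hi hj) _ _

theorem mul {A : Type*} [CommSemiring A] {f g : (Fin k → V) → A} (hf : AdditiveOn S f)
    (hg : AdditiveOn T g) (hST : Disjoint S T) : AdditiveOn (S ∪ T) (fun x => f x * g x) := by
  refine ⟨fun x y h => ?_, fun i hi x u v => ?_⟩
  · simp only [hf.1 x y fun i hi => h i (mem_union_left _ hi),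
      hg.1 x y fun i hi => h i (mem_union_right _ hi)]
  · rcases mem_union.1 hi with hi | hi
    · simp only [hf.2 i hi, hg.update_of_notMem (disjoint_left.1 hST hi)]; ring
    · simp only [hg.2 i hi, hf.update_of_notMem (disjoint_right.1 hST hi)]; ring

theorem piecewise [AddCommMonoid M] {f : (Fin k → V) → M} (hf : AdditiveOn S f)
    (B : Finset (Fin k)) (c : Fin k → V) : AdditiveOn (S \ B) (fun x => f (B.piecewise c x)) := by
  refine ⟨fun x y h => hf.1 _ _ fun i hi => ?_, fun i hi x u v => ?_⟩
  · by_cases hB : i ∈ B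
    · simp [hB]
    · simp [hB, h i (mem_sdiff.2 ⟨hi, hB⟩)]
  · obtain ⟨hi, hB⟩ := mem_sdiff.1 hi
    have key : ∀ w : V, B.piecewise c (Function.update x i w) =
        Function.update (B.piecewise c x) i w := fun w =>
      (Finset.update_piecewise_of_notMem _ _ _ hB _).symm
    simp only [key, hf.2 i hi]

theorem perm [AddCommMonoid M] {f : (Fin k → V) → M} (hf : AdditiveOn univ f)
    (π : Equiv.Perm (Fin k)) : AdditiveOn univ (fun x => f (fun i => x (π i))) := by
  refine ⟨fun x y h => hf.1 _ _ fun i _ => h _ (mem_univ _), fun i _ x u v => ?_⟩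
  have key : ∀ w : V, (fun j => Function.update x i w (π j)) =
      Function.update (fun j => x (π j)) (π.symm i) w := fun w => by
    ext1 j
    by_cases h : π j = i
    · subst h; simp
    · have : j ≠ π.symm i := fun h' => h (by simp [h'])
      simp [h, this]
  simp only [key, hf.2 _ (mem_univ _)]

end AdditiveOn

end MultilinearOnSubset

section ListSums

/-- `h` is a sum of at most `N` elements satisfying `P`. -/
def SumOf {M : Type*} [AddCommMonoid M] (P : M → Prop) (N : ℕ) (h : M) : Prop :=
  ∃ l : List M, l.length ≤ N ∧ (∀ a ∈ l, P a) ∧ l.sum = h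

namespace SumOf

variable {M : Type*} [AddCommMonoid M] {P Q : M → Prop} {N N' : ℕ} {h h' : M}

theorem zero : SumOf P 0 (0 : M) := ⟨[], by simp⟩

theorem single (hh : P h) : SumOf P 1 h := ⟨[h], by simpa using hh⟩

theorem mono (H : SumOf P N h) (hPQ : ∀ a, P a → Q a) (hN : N ≤ N') : SumOf Q N' h := by
  obtain ⟨l, h1, h2, h3⟩ := H
  exact ⟨l, h1.trans hN, fun a ha => hPQ a (h2 a ha), h3⟩

theorem add (H : SumOf P N h) (H' : SumOf P N' h') : SumOf P (N + N') (h + h') := by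
  obtain ⟨l, h1, h2, h3⟩ := H
  obtain ⟨l', h1', h2', h3'⟩ := H'
  refine ⟨l ++ l', by simp; omega, fun a ha => ?_, by simp [h3, h3']⟩
  rcases List.mem_append.1 ha with ha | ha
  exacts [h2 a ha, h2' a ha]

theorem sum {ι : Type*} (s : Finset ι) {f : ι → M} (H : ∀ a ∈ s, SumOf P N (f a)) :
    SumOf P (s.card * N) (∑ a ∈ s, f a) := by
  classical
  induction s using Finset.induction_on with
  | empty => simpa using zero
  | insert a s ha ih =>
    rw [sum_insert ha, card_insert_of_notMem ha, Nat.succ_mul, add_comm (s.card * N)]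
    exact (H a (mem_insert_self _ _)).add (ih fun b hb => H b (mem_insert_of_mem hb))

theorem map {M' : Type*} [AddCommMonoid M'] {P' : M' → Prop} (H : SumOf P N h) (φ : M →+ M')
    (hφ : ∀ a, P a → P' (φ a)) : SumOf P' N (φ h) := by
  obtain ⟨l, h1, h2, rfl⟩ := H
  refine ⟨l.map φ, by simpa using h1, fun a ha => ?_, (map_list_sum φ l).symm⟩
  obtain ⟨b, hb, rfl⟩ := List.mem_map.1 ha
  exact hφ b (h2 b hb)

theorem induction_on {motive : ℕ → M → Prop} (H : SumOf P N h) (zero : motive 0 0)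
    (mono : ∀ N N' h, N ≤ N' → motive N h → motive N' h)
    (add : ∀ N a h, P a → motive N h → motive (N + 1) (a + h)) : motive N h := by
  obtain ⟨l, h1, h2, rfl⟩ := H
  refine mono _ _ _ h1 ?_
  clear h1
  induction l with
  | nil => simpa using zero
  | cons a l ih =>
    simpa using add _ a _ (h2 a (by simp)) (ih fun b hb => h2 b (by simp [hb]))

theorem split (H : SumOf (fun a => P a ∨ Q a) N h) :
    ∃ h₁ h₂, SumOf P N h₁ ∧ SumOf Q N h₂ ∧ h = h₁ + h₂ := by
  refine H.induction_on (motive := fun N h => ∃ h₁ h₂, SumOf P N h₁ ∧ SumOf Q N h₂ ∧ h = h₁ + h₂)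
    ⟨0, 0, zero, zero, (add_zero 0).symm⟩ ?_ ?_
  · rintro N N' h hN ⟨h₁, h₂, H₁, H₂, e⟩
    exact ⟨h₁, h₂, H₁.mono (fun _ => id) hN, H₂.mono (fun _ => id) hN, e⟩
  · rintro N a h (ha | ha) ⟨h₁, h₂, H₁, H₂, rfl⟩
    · exact ⟨h₁ + a, h₂, H₁.add (single ha), H₂.mono (fun _ => id) (by omega), by abel⟩
    · exact ⟨h₁, h₂ + a, H₁.mono (fun _ => id) (by omega), H₂.add (single ha), by abel⟩

end SumOf

end ListSums

section Elimination

variable {k : ℕ} {V : Type*} [AddCommGroup V] {p q : Fin k}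

/-- A product of two forms in complementary nonempty sets of variables. -/
def ProductForm (h : (Fin k → V) → ZMod 2) : Prop :=
  ∃ (J : Finset (Fin k)) (f g : (Fin k → V) → ZMod 2), J ≠ ∅ ∧ J ≠ univ ∧
    AdditiveOn Jᶜ f ∧ AdditiveOn J g ∧ h = f * g

/-- `σ = β + β∘(p q)` for some `β` of partition rank at most `N`. -/
def Symmetrizable (p q : Fin k) (N : ℕ) (σ : (Fin k → V) → ZMod 2) : Prop :=
  ∃ β, SumOf ProductForm N β ∧ σ = β + permForm k (Equiv.swap p q) β

/-- `σ = ρ + ρ∘(p q)` for some multilinear `ρ`. -/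
def IsSymmetrization (p q : Fin k) (σ : (Fin k → V) → ZMod 2) : Prop :=
  ∃ ρ, AdditiveOn univ ρ ∧ σ = ρ + permForm k (Equiv.swap p q) ρ

/-- A product of a form in `Jᶜ ∋ p` and a form in `J`, where either `J` contains `q` or `J` belongs
to the family `𝓤`. -/
def SplitForm (p q : Fin k) (𝓤 : Finset (Finset (Fin k))) (h : (Fin k → V) → ZMod 2) : Prop :=
  ∃ (J : Finset (Fin k)) (f g : (Fin k → V) → ZMod 2), p ∉ J ∧ (q ∈ J ∨ J ∈ 𝓤) ∧
    AdditiveOn Jᶜ f ∧ AdditiveOn J g ∧ h = f * g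

/-- A product of a form in `Bᶜ` and a form in `B`. -/
def BlockForm (B : Finset (Fin k)) (h : (Fin k → V) → ZMod 2) : Prop :=
  ∃ f g : (Fin k → V) → ZMod 2, AdditiveOn Bᶜ f ∧ AdditiveOn B g ∧ h = f * g

/-- Substitute the vectors `c` for the variables in `B`, then multiply by `g`. -/
def substMul (B : Finset (Fin k)) (c : Fin k → V) (g : (Fin k → V) → ZMod 2) :
    ((Fin k → V) → ZMod 2) →+ ((Fin k → V) → ZMod 2) where
  toFun h := fun x => g x * h (B.piecewise c x)
  map_zero' := by ext x; simp
  map_add' h h' := by ext x; simp [mul_add]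

theorem permForm_add {k : ℕ} {V : Type*} {π : Equiv.Perm (Fin k)} (f g : (Fin k → V) → ZMod 2) :
    permForm k π (f + g) = permForm k π f + permForm k π g := rfl

theorem Symmetrizable.add {N N' : ℕ} {σ σ' : (Fin k → V) → ZMod 2} (h : Symmetrizable p q N σ)
    (h' : Symmetrizable p q N' σ') : Symmetrizable p q (N + N') (σ + σ') := by
  obtain ⟨β, hβ, rfl⟩ := h
  obtain ⟨β', hβ', rfl⟩ := h'
  exact ⟨β + β', hβ.add hβ', by rw [permForm_add]; abel⟩

theorem Symmetrizable.mono {N N' : ℕ} {σ : (Fin k → V) → ZMod 2} (h : Symmetrizable p q N σ)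
    (hN : N ≤ N') : Symmetrizable p q N' σ := by
  obtain ⟨β, hβ, rfl⟩ := h
  exact ⟨β, hβ.mono (fun _ => id) hN, rfl⟩

theorem Symmetrizable.zero : Symmetrizable p q 0 (0 : (Fin k → V) → ZMod 2) :=
  ⟨0, SumOf.zero, by ext x; simp [permForm]⟩

theorem IsSymmetrization.add {σ σ' : (Fin k → V) → ZMod 2} (h : IsSymmetrization p q σ)
    (h' : IsSymmetrization p q σ') : IsSymmetrization p q (σ + σ') := by
  obtain ⟨ρ, hρ, rfl⟩ := h
  obtain ⟨ρ', hρ', rfl⟩ := h'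
  exact ⟨ρ + ρ', hρ.add hρ', by rw [permForm_add]; abel⟩

theorem ProductForm.additiveOn {h : (Fin k → V) → ZMod 2} (H : ProductForm h) :
    AdditiveOn univ h := by
  obtain ⟨J, f, g, -, -, hf, hg, rfl⟩ := H
  have := hf.mul hg disjoint_compl_left
  rwa [union_comm, union_compl] at this

theorem SumOf.additiveOn {N : ℕ} {h : (Fin k → V) → ZMod 2} (H : SumOf ProductForm N h) :
    AdditiveOn univ h :=
  H.induction_on (motive := fun _ h => AdditiveOn univ h) AdditiveOn.zero
    (fun _ _ _ _ h => h) fun _ _ _ ha h => ha.additiveOn.add h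

theorem Symmetrizable.isSymmetrization {N : ℕ} {σ : (Fin k → V) → ZMod 2}
    (h : Symmetrizable p q N σ) : IsSymmetrization p q σ := by
  obtain ⟨β, hβ, rfl⟩ := h
  exact ⟨β, hβ.additiveOn, rfl⟩

theorem BlockForm.productForm {B : Finset (Fin k)} (hB : B ≠ ∅) (hB' : B ≠ univ)
    {h : (Fin k → V) → ZMod 2} (H : BlockForm B h) : ProductForm h := by
  obtain ⟨f, g, hf, hg, rfl⟩ := H
  exact ⟨B, f, g, hB, hB', hf, hg, rfl⟩

/-- Substituting for a block of variables avoiding `p` and `q` commutes with exchanging `p`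
and `q`. -/
theorem IsSymmetrization.symmetrizable_substMul {σ : (Fin k → V) → ZMod 2}
    (h : IsSymmetrization p q σ) {B : Finset (Fin k)} (hB : B ≠ ∅) (hp : p ∉ B) (hq : q ∉ B)
    (c : Fin k → V) {g : (Fin k → V) → ZMod 2} (hg : AdditiveOn B g) :
    Symmetrizable p q 1 (substMul B c g σ) := by
  obtain ⟨ρ, hρ, rfl⟩ := h
  have hfix : ∀ i ∈ B, Equiv.swap p q i = i := fun i hi =>
    Equiv.swap_apply_of_ne_of_ne (by rintro rfl; exact hp hi) (by rintro rfl; exact hq hi)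
  have hB' : B ≠ univ := by rintro rfl; exact hp (mem_univ _)
  refine ⟨substMul B c g ρ, SumOf.single (BlockForm.productForm hB hB'
    ⟨fun x => ρ (B.piecewise c x), g, ?_, hg, ?_⟩), ?_⟩
  · simpa [compl_eq_univ_sdiff] using hρ.piecewise B c
  · ext x; exact mul_comm _ _
  · rw [map_add]
    congr 1
    ext x
    simp only [substMul, permForm, AddMonoidHom.coe_mk, ZeroHom.coe_mk, Equiv.symm_swap]
    rw [hg.1 (fun i => x (Equiv.swap p q i)) x fun i hi => by rw [hfix i hi]]
    congr 2
    ext1 i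
    by_cases hi : i ∈ B
    · simp [hi, hfix i hi]
    · have : Equiv.swap p q i ∉ B := by
        intro h'
        have := hfix _ h'
        rw [Equiv.swap_apply_self] at this
        exact hi (this ▸ h')
      simp [hi, this]

theorem SplitForm.substMul {𝓤 : Finset (Finset (Fin k))} {B : Finset (Fin k)} (hp : p ∉ B)
    (hq : q ∉ B) (hU : ∀ J ∈ 𝓤, J ∪ B ∈ 𝓤) (c : Fin k → V) {g : (Fin k → V) → ZMod 2}
    (hg : AdditiveOn B g) {h : (Fin k → V) → ZMod 2} (H : SplitForm p q 𝓤 h) :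
    SplitForm p q 𝓤 (substMul B c g h) := by
  obtain ⟨J, f', g', hpJ, hJ, hf', hg', rfl⟩ := H
  have hf := hf'.piecewise B c
  have hg₂ := hg'.piecewise B c
  rcases hJ with hJ | hJ
  · refine ⟨J \ B, fun x => g x * f' (B.piecewise c x), _, by simp [hpJ],
      Or.inl (by simp [hJ, hq]), ?_, hg₂, ?_⟩
    · have := hg.mul hf disjoint_sdiff
      convert this using 1
      ext i; simp; tauto
    · ext x; simp [_root_.substMul, mul_assoc]
  · refine ⟨J ∪ B, fun x => f' (B.piecewise c x), fun x => g' (B.piecewise c x) * g x,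
      by simp [hpJ, hp], Or.inr (hU J hJ), ?_, ?_, ?_⟩
    · convert hf using 1
      ext i; simp
    · have := hg₂.mul hg sdiff_disjoint
      simpa using this
    · ext x; simp [_root_.substMul]; ring

theorem zmod_two_fun_add_self {X : Type*} (f : X → ZMod 2) : f + f = 0 :=
  funext fun x => CharTwo.add_self_eq_zero (f x)

theorem BlockForm.add_substMul {B : Finset (Fin k)} (c : Fin k → V) {g : (Fin k → V) → ZMod 2}
    (hg : AdditiveOn B g) {h : (Fin k → V) → ZMod 2} (H : BlockForm B h) :
    BlockForm B (h + substMul B c g h) := by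
  obtain ⟨f', g', hf', hg', rfl⟩ := H
  refine ⟨f', fun x => g' x + g' c * g x, hf', hg'.add ?_, ?_⟩
  · simpa using (AdditiveOn.const (V := V) (g' c)).mul hg (disjoint_empty_left _)
  · ext x
    have e1 : f' (B.piecewise c x) = f' x := hf'.1 _ _ fun i hi => by
      simp [mem_compl.1 hi]
    have e2 : g' (B.piecewise c x) = g' c := hg'.1 _ _ fun i hi => by simp [hi]
    simp only [substMul, Pi.add_apply, Pi.mul_apply, AddMonoidHom.coe_mk, ZeroHom.coe_mk, e1, e2]
    ring

theorem eliminate_block {𝓤 : Finset (Finset (Fin k))} {B : Finset (Fin k)} (hB : B ≠ ∅)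
    (hp : p ∉ B) (hq : q ∉ B) (hU : ∀ J ∈ 𝓤, J ∪ B ∈ 𝓤) (s : ℕ) :
    ∀ (N : ℕ) (σ₁ σ₂ : (Fin k → V) → ZMod 2), IsSymmetrization p q (σ₁ + σ₂) →
      SumOf (SplitForm p q 𝓤) N σ₁ → SumOf (BlockForm B) s σ₂ →
      ∃ σ', IsSymmetrization p q σ' ∧ Symmetrizable p q s (σ₁ + σ₂ + σ') ∧
        SumOf (SplitForm p q 𝓤) (N * 2 ^ s) σ' := by
  induction s with
  | zero =>
    rintro N σ₁ σ₂ hσ h₁ ⟨l, hl, -, rfl⟩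
    obtain rfl : l = [] := by simpa using hl
    refine ⟨σ₁, by simpa using hσ, ?_, by simpa using h₁⟩
    simpa [zmod_two_fun_add_self] using Symmetrizable.zero
  | succ s ih =>
    rintro N σ₁ σ₂ hσ h₁ ⟨l, hl, hl', rfl⟩
    rcases l with _ | ⟨h, l⟩
    · obtain ⟨σ', h1, h2, h3⟩ := ih N σ₁ 0 (by simpa using hσ) h₁ ⟨[], by simp⟩
      exact ⟨σ', h1, by simpa using h2.mono s.le_succ,
        h3.mono (fun _ => id) (Nat.mul_le_mul_left _ (Nat.pow_le_pow_right two_pos s.le_succ))⟩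
    · obtain ⟨f, g, hf, hg, rfl⟩ := hl' h (by simp)
      have hl₂ : SumOf (BlockForm B) s l.sum :=
        ⟨l, by simpa using hl, fun a ha => hl' a (by simp [ha]), rfl⟩
      by_cases hg0 : ∀ x, g x = 0
      · obtain rfl : g = 0 := funext hg0
        obtain ⟨σ', h1, h2, h3⟩ := ih N σ₁ l.sum (by simpa using hσ) h₁ hl₂
        exact ⟨σ', h1, by simpa using h2.mono s.le_succ,
          h3.mono (fun _ => id) (Nat.mul_le_mul_left _ (Nat.pow_le_pow_right two_pos s.le_succ))⟩
      · push Not at hg0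
        obtain ⟨c, hc⟩ := hg0
        have hc1 : g c = 1 := by
          generalize g c = a at hc ⊢
          revert a; decide
        set φ := substMul B c g with hφ
        have hsym := hσ.symmetrizable_substMul hB hp hq c hg
        rw [← hφ] at hsym
        have hkill : f * g + φ (f * g) = 0 := by
          ext x
          have e1 : f (B.piecewise c x) = f x := hf.1 _ _ fun i hi => by
            simp [mem_compl.1 hi]
          have e2 : g (B.piecewise c x) = 1 := by
            rw [← hc1]; exact hg.1 _ _ fun i hi => by simp [hi]
          simp only [hφ, substMul, Pi.add_apply, Pi.mul_apply, AddMonoidHom.coe_mk,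
            ZeroHom.coe_mk, e1, e2, Pi.zero_apply]
          rw [mul_one, mul_comm (g x)]
          exact CharTwo.add_self_eq_zero _
        have e : σ₁ + (f * g :: l).sum + φ (σ₁ + (f * g :: l).sum) =
            (σ₁ + φ σ₁) + (l.sum + φ l.sum) := by
          rw [List.sum_cons, map_add, map_add]
          linear_combination hkill
        obtain ⟨σ', h1, h2, h3⟩ := ih (N + N) (σ₁ + φ σ₁) (l.sum + φ l.sum)
          (e ▸ hσ.add hsym.isSymmetrization)
          (h₁.add (h₁.map φ fun a ha => ha.substMul hp hq hU c hg))
          (hl₂.map (AddMonoidHom.id _ + φ) fun a ha => ha.add_substMul c hg)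
        refine ⟨σ', h1, ?_, h3.mono (fun _ => id) (by rw [pow_succ]; apply le_of_eq; ring)⟩
        have := h2.add hsym
        rw [← e] at this
        convert this using 1
        linear_combination -zmod_two_fun_add_self (φ (σ₁ + (f * g :: l).sum))

theorem self_mul_two_pow_le (N : ℕ) : N * 2 ^ N ≤ 4 ^ N := by
  calc N * 2 ^ N ≤ 2 ^ N * 2 ^ N := Nat.mul_le_mul_right _ Nat.lt_two_pow_self.le
    _ = 4 ^ N := (mul_pow 2 2 N).symm

theorem two_mul_le_four_pow (N : ℕ) : 2 * N ≤ 4 ^ N := by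
  have h1 : N < 2 ^ N := Nat.lt_two_pow_self
  have h2 : (4 : ℕ) ^ N = 2 ^ N * 2 ^ N := mul_pow 2 2 N
  nlinarith [Nat.one_le_two_pow (n := N)]

theorem le_four_pow (N : ℕ) : N ≤ 4 ^ N := by have := two_mul_le_four_pow N; omega

theorem le_iterate_four_pow (s N : ℕ) : N ≤ (4 ^ ·)^[s] N := by
  induction s with
  | zero => simp
  | succ s ih =>
    rw [Function.iterate_succ_apply']
    exact ih.trans (le_four_pow _)

/-- Every symmetrization of bounded partition rank can be changed by a symmetrizable form so that no
term of its decomposition has `p` and `q` in the same factor. -/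
theorem eliminate_unsplit (m : ℕ) : ∀ 𝓤 : Finset (Finset (Fin k)), 𝓤.card = m →
    (∀ J ∈ 𝓤, J ≠ ∅ ∧ p ∉ J ∧ q ∉ J) →
    (∀ J ∈ 𝓤, ∀ L, J ⊆ L → p ∉ L → q ∉ L → L ∈ 𝓤) →
    ∀ (N : ℕ) (σ : (Fin k → V) → ZMod 2), IsSymmetrization p q σ →
      SumOf (SplitForm p q 𝓤) N σ →
      ∃ σ', IsSymmetrization p q σ' ∧ Symmetrizable p q ((4 ^ ·)^[2 * m] N) (σ + σ') ∧
        SumOf (SplitForm p q ∅) ((4 ^ ·)^[2 * m] N) σ' := by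
  induction m with
  | zero =>
    refine fun 𝓤 hm _ _ N σ hσ h => ⟨σ, hσ, ?_, ?_⟩
    · rw [zmod_two_fun_add_self]
      exact Symmetrizable.zero.mono (Nat.zero_le _)
    · rwa [card_eq_zero.1 hm] at h
  | succ m ih =>
    intro 𝓤 hm hU hup N σ hσ h
    rw [show 2 * (m + 1) = 2 * m + 2 by ring]
    set s := 2 * m
    have hne : 𝓤.Nonempty := card_pos.1 (by omega)
    obtain ⟨B, hB⟩ := 𝓤.exists_minimal hne
    obtain ⟨hB0, hBp, hBq⟩ := hU B hB.1
    have hmin : ∀ J ∈ 𝓤, J ⊆ B → J = B := fun J hJ hJB => hJB.antisymm (hB.2 hJ hJB)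
    have hup' : ∀ J ∈ 𝓤.erase B, ∀ L, J ⊆ L → p ∉ L → q ∉ L → L ∈ 𝓤.erase B := by
      intro J hJ L hJL hp hq
      rw [mem_erase] at hJ ⊢
      refine ⟨?_, hup J hJ.2 L hJL hp hq⟩
      rintro rfl
      exact hJ.1 (hmin J hJ.2 hJL)
    obtain ⟨σ₁, σ₂, h₁, h₂, rfl⟩ := SumOf.split (P := SplitForm p q (𝓤.erase B))
      (Q := BlockForm B) (h.mono (fun a ha => by
        obtain ⟨J, f, g, hp, hJ, hf, hg, rfl⟩ := ha
        by_cases hJB : J = B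
        · subst hJB; exact Or.inr ⟨f, g, hf, hg, rfl⟩
        · exact Or.inl ⟨J, f, g, hp, hJ.imp_right fun hJ => mem_erase.2 ⟨hJB, hJ⟩, hf, hg, rfl⟩)
        le_rfl)
    obtain ⟨σ', h1, h2, h3⟩ := eliminate_block hB0 hBp hBq (fun J hJ => hup' J hJ _
      subset_union_left
      (by simpa [hBp] using (hU J (mem_of_mem_erase hJ)).2.1)
      (by simpa [hBq] using (hU J (mem_of_mem_erase hJ)).2.2)) N N σ₁ σ₂ hσ h₁ h₂
    obtain ⟨σ'', h1', h2', h3'⟩ := ih (𝓤.erase B) (by rw [card_erase_of_mem hB.1, hm]; rfl)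
      (fun J hJ => hU J (mem_of_mem_erase hJ)) hup' (4 ^ N) σ' h1
      (h3.mono (fun _ => id) (self_mul_two_pow_le N))
    have hs : (4 ^ ·)^[s] (4 ^ N) = (4 ^ ·)^[s + 1] N := (Function.iterate_succ_apply _ _ _).symm
    rw [hs] at h2' h3'
    have hs2 : 2 * (4 ^ ·)^[s + 1] N ≤ (4 ^ ·)^[s + 2] N := by
      rw [Function.iterate_succ_apply' _ (s + 1)]
      exact two_mul_le_four_pow _
    have hs1 := le_iterate_four_pow (s + 1) N
    refine ⟨σ'', h1', ?_, h3'.mono (fun _ => id) (by omega)⟩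
    have := (h2.add h2').mono (N' := (4 ^ ·)^[s + 2] N) (by omega)
    convert this using 1
    linear_combination -zmod_two_fun_add_self σ'

end Elimination

section ScalarExtension

variable {k n : ℕ} {A B : Type*} [CommRing A] [Algebra (ZMod 2) A] [CommRing B] [Algebra (ZMod 2) B]

/-- The multilinear extension of a form on `𝔽₂ⁿ` to points with coordinates in an
`𝔽₂`-algebra. -/
def scalarExt (f : (Fin k → Fin n → ZMod 2) → ZMod 2) (ζ : Fin k → Fin n → A) : A :=
  ∑ j : Fin k → Fin n, algebraMap (ZMod 2) A (f fun i => Pi.single (j i) 1) * ∏ i, ζ i (j i)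

theorem scalarExt_add (f g : (Fin k → Fin n → ZMod 2) → ZMod 2) (ζ : Fin k → Fin n → A) :
    scalarExt (f + g) ζ = scalarExt f ζ + scalarExt g ζ := by
  simp [scalarExt, add_mul, sum_add_distrib]

theorem map_scalarExt (φ : A →+* B) (f : (Fin k → Fin n → ZMod 2) → ZMod 2)
    (ζ : Fin k → Fin n → A) : φ (scalarExt f ζ) = scalarExt f (fun i t => φ (ζ i t)) := by
  have h : ∀ a : ZMod 2, φ (algebraMap (ZMod 2) A a) = algebraMap (ZMod 2) B a := fun a =>
    RingHom.congr_fun (RingHom.ext_zmod (φ.comp (algebraMap (ZMod 2) A)) (algebraMap (ZMod 2) B)) a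
  simp [scalarExt, map_sum, map_mul, map_prod, h]

theorem scalarExt_permForm (π : Equiv.Perm (Fin k)) (f : (Fin k → Fin n → ZMod 2) → ZMod 2)
    (ζ : Fin k → Fin n → A) :
    scalarExt (permForm k π f) ζ = scalarExt f (fun i => ζ (π.symm i)) := by
  unfold scalarExt permForm
  refine Fintype.sum_equiv (Equiv.arrowCongr π (Equiv.refl _)) _ _ fun j => ?_
  congr 1
  exact (Equiv.prod_comp π.symm fun i => ζ i (j i)).symm

/-- The extension of a product of forms in complementary sets of variables is a product of functions
of the same sets of variables. -/
theorem exists_scalarExt_mul (J : Finset (Fin k)) {f g : (Fin k → Fin n → ZMod 2) → ZMod 2}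
    (hf : ∀ x y, (∀ i ∈ Jᶜ, x i = y i) → f x = f y) (hg : ∀ x y, (∀ i ∈ J, x i = y i) → g x = g y) :
    ∃ F G : (Fin k → Fin n → A) → A, (∀ x y, (∀ i ∈ Jᶜ, x i = y i) → F x = F y) ∧
      (∀ x y, (∀ i ∈ J, x i = y i) → G x = G y) ∧ ∀ ζ, scalarExt (f * g) ζ = F ζ * G ζ := by
  classical
  refine ⟨fun ζ => ∑ a : {i // ¬ i ∈ J} → Fin n, algebraMap (ZMod 2) A
      (f fun i => if h : i ∉ J then Pi.single (a ⟨i, h⟩) 1 else 0) * ∏ i, ζ i.1 (a i),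
    fun ζ => ∑ a : {i // i ∈ J} → Fin n, algebraMap (ZMod 2) A
      (g fun i => if h : i ∈ J then Pi.single (a ⟨i, h⟩) 1 else 0) * ∏ i, ζ i.1 (a i),
    fun x y h => ?_, fun x y h => ?_, fun ζ => ?_⟩
  · refine sum_congr rfl fun a _ => ?_
    congr 1
    exact prod_congr rfl fun i _ => by rw [h i.1 (mem_compl.2 i.2)]
  · refine sum_congr rfl fun a _ => ?_
    congr 1
    exact prod_congr rfl fun i _ => by rw [h i.1 i.2]
  · conv_rhs => rw [mul_comm, sum_mul_sum, ← Fintype.sum_prod_type']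
    refine Fintype.sum_equiv (Equiv.piEquivPiSubtypeProd (fun i => i ∈ J) fun _ => Fin n) _ _
      fun j => ?_
    have hprod : ∏ i, ζ i (j i) =
        (∏ i : {i // i ∈ J}, ζ i (j i)) * ∏ i : {i // ¬ i ∈ J}, ζ i (j i) := by
      rw [← Fintype.prod_subtype_mul_prod_subtype (fun i => i ∈ J)]
      congr!
    rw [hprod]
    simp only [Pi.mul_apply, map_mul, Equiv.piEquivPiSubtypeProd_apply]
    rw [hf (fun i => Pi.single (j i) 1) (fun i => if h : i ∉ J then Pi.single (j i) 1 else 0)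
        fun i hi => by simp [mem_compl.1 hi],
      hg (fun i => Pi.single (j i) 1) (fun i => if h : i ∈ J then Pi.single (j i) 1 else 0)
        fun i hi => by simp [hi]]
    ring

/-- The bilinear form on `𝔽₂ⁿ` obtained by fixing all variables other than `p` and `q`. -/
def bilinSlice (p q : Fin k) (f : (Fin k → Fin n → ZMod 2) → ZMod 2) (ζ : Fin k → Fin n → A)
    (a b : Fin n → ZMod 2) : A :=
  scalarExt f (Function.update (Function.update ζ p fun t => algebraMap (ZMod 2) A (a t)) q
    fun t => algebraMap (ZMod 2) A (b t))

variable {p q : Fin k}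

theorem map_bilinSlice (φ : A →+* B) (f : (Fin k → Fin n → ZMod 2) → ZMod 2)
    (ζ : Fin k → Fin n → A) (a b : Fin n → ZMod 2) :
    φ (bilinSlice p q f ζ a b) = bilinSlice p q f (fun i t => φ (ζ i t)) a b := by
  have h : ∀ a : ZMod 2, φ (algebraMap (ZMod 2) A a) = algebraMap (ZMod 2) B a := fun a =>
    RingHom.congr_fun (RingHom.ext_zmod (φ.comp (algebraMap (ZMod 2) A)) (algebraMap (ZMod 2) B)) a
  rw [bilinSlice, map_scalarExt, bilinSlice]
  congr 1
  ext i t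
  by_cases hq : i = q
  · subst hq; simp [h]
  · by_cases hp : i = p
    · subst hp; simp [h, hq]
    · simp [hp, hq]

theorem bilinSlice_add_permForm (hpq : p ≠ q) (f : (Fin k → Fin n → ZMod 2) → ZMod 2)
    (ζ : Fin k → Fin n → A) (a b : Fin n → ZMod 2) :
    bilinSlice p q (f + permForm k (Equiv.swap p q) f) ζ a b =
      bilinSlice p q f ζ a b + bilinSlice p q f ζ b a := by
  simp only [bilinSlice, scalarExt_add, scalarExt_permForm]
  congr 2
  ext1 i
  by_cases hp : i = p
  · subst hp; simp [hpq]
  · by_cases hq : i = q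
    · subst hq; simp [hpq]
    · simp [hp, hq, Equiv.swap_apply_of_ne_of_ne]

theorem matrix_rank_add_le {K m n : Type*} [Field K] [Fintype m] [Fintype n] (M N : Matrix m n K) :
    (M + N).rank ≤ M.rank + N.rank := by
  rw [Matrix.rank, Matrix.mulVecLin_add]
  have h := LinearMap.rank_add_le M.mulVecLin N.mulVecLin
  simp only [LinearMap.rank, ← Module.finrank_eq_rank] at h
  exact_mod_cast h

/-- The slices of a sum of `N` products separating `p` from `q` have rank at most `N`. -/
theorem rank_bilinSlice_le {K : Type*} [Field K] [Algebra (ZMod 2) K] (hpq : p ≠ q) {N r : ℕ}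
    {σ : (Fin k → Fin n → ZMod 2) → ZMod 2} (h : SumOf (SplitForm p q ∅) N σ)
    (ζ : Fin k → Fin n → K) (u v : Fin r → Fin n → ZMod 2) :
    (Matrix.of fun i j => bilinSlice p q σ ζ (u i) (v j)).rank ≤ N := by
  refine h.induction_on (motive := fun N σ =>
    (Matrix.of fun i j => bilinSlice p q σ ζ (u i) (v j)).rank ≤ N) ?_
    (fun _ _ _ hN h => h.trans hN) ?_
  · have : (Matrix.of fun i j => bilinSlice p q 0 ζ (u i) (v j)) = 0 := by
      ext i j; simp [bilinSlice, scalarExt]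
    rw [this, Matrix.rank_zero]
  · rintro N σ' σ'' ⟨J, f, g, hp, hq, hf, hg, rfl⟩ ih
    replace hq : q ∈ J := by simpa using hq
    obtain ⟨F, G, hF, hG, hFG⟩ := exists_scalarExt_mul (A := K) J hf.1 hg.1
    have e : (Matrix.of fun i j => bilinSlice p q (f * g + σ'') ζ (u i) (v j)) =
        Matrix.vecMulVec
          (fun i => F (Function.update ζ p fun t => algebraMap (ZMod 2) K (u i t)))
          (fun j => G (Function.update ζ q fun t => algebraMap (ZMod 2) K (v j t))) +
        Matrix.of fun i j => bilinSlice p q σ'' ζ (u i) (v j) := by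
      ext i j
      simp only [Matrix.of_apply, Matrix.add_apply, Matrix.vecMulVec_apply, bilinSlice, scalarExt_add,
        hFG]
      congr 2
      · exact hF _ _ fun l hl => by
          rw [Function.update_of_ne]
          rintro rfl; exact mem_compl.1 hl hq
      · refine hG _ _ fun l hl => ?_
        have : l ≠ p := by rintro rfl; exact hp hl
        by_cases hlq : l = q
        · subst hlq; simp
        · simp [hlq, this]
    rw [e, add_comm N]
    exact (matrix_rank_add_le _ _).trans (add_le_add (Matrix.rank_vecMulVec_le _ _) ih)

end ScalarExtension

section LinearAlgebra

variable {A : Type*} [CommRing A]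

/-- If a bordered matrix has determinant zero, its corner is determined by the other blocks. -/
theorem det_mul_eq_of_det_bordered_eq_zero [IsDomain A] {r : ℕ} {M : Matrix (Fin r) (Fin r) A}
    (hM : M.det ≠ 0) (b : Fin r → A) (c : Fin r → A) (e : A)
    (h : (Matrix.fromBlocks M (Matrix.replicateCol Unit b) (Matrix.replicateRow Unit c)
      (Matrix.of fun _ _ => e)).det = 0) :
    M.det * e = ∑ j, ∑ i, c j * M.adjugate j i * b i := by
  have key : Matrix.fromBlocks M (Matrix.replicateCol Unit b) (Matrix.replicateRow Unit c)
      (Matrix.of fun _ _ => e) *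
      Matrix.fromBlocks M.adjugate (-(M.adjugate * Matrix.replicateCol Unit b)) 0
        (Matrix.diagonal fun _ => M.det) =
      Matrix.fromBlocks (Matrix.diagonal fun _ => M.det) 0
        (Matrix.replicateRow Unit c * M.adjugate)
        (Matrix.of fun _ _ => M.det * e - ∑ j, ∑ i, c j * M.adjugate j i * b i) := by
    rw [Matrix.fromBlocks_multiply]
    congr 1
    · simp [Matrix.mul_adjugate, Matrix.smul_one_eq_diagonal]
    · rw [Matrix.mul_neg, ← Matrix.mul_assoc, Matrix.mul_adjugate]
      ext i j
      simp [Matrix.mul_apply, mul_comm]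
    · simp
    · ext i j
      simp only [Matrix.mul_neg, Matrix.add_apply, Matrix.neg_apply, Matrix.mul_apply,
        Matrix.replicateRow_apply, Matrix.replicateCol_apply, Matrix.of_apply, mul_sum]
      simp [mul_comm, mul_left_comm]
      ring
  have hdet := congr_arg Matrix.det key
  rw [Matrix.det_mul, h, zero_mul, Matrix.det_fromBlocks_zero₁₂, Matrix.det_diagonal] at hdet
  simp only [prod_const, card_univ, Fintype.card_fin, Matrix.det_unique, Matrix.of_apply] at hdet
  rcases mul_eq_zero.1 hdet.symm with h0 | h0
  · exact absurd h0 (pow_ne_zero _ hM)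
  · exact sub_eq_zero.1 h0

/-- If `s a b = r a b + r b a` is determined by an invertible minor, then `det² • s` is the
symmetrization of an expression bilinear in the rows of the minor. -/
theorem det_sq_mul_eq_symmetrization {W : Type*} {m : ℕ} {s r : W → W → A}
    (hs : ∀ a b, s a b = r a b + r b a) {u v : Fin m → W} {D : A} {N : Matrix (Fin m) (Fin m) A}
    (hcross : ∀ a b, D * s a b = ∑ j, ∑ i, s a (v j) * N j i * s (u i) b) (a b : W) :
    D ^ 2 * s a b =
      ∑ l, (∑ i, (∑ j, s a (v j) * N j i) * r (u i) (u l)) * (∑ j, s b (v j) * N j l) +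
      ∑ l, (∑ i, (∑ j, s b (v j) * N j i) * r (u i) (u l)) * (∑ j, s a (v j) * N j l) := by
  have hsym : ∀ a b, s a b = s b a := fun a b => by rw [hs, hs b a, add_comm]
  set c : W → Fin m → A := fun a i => ∑ j, s a (v j) * N j i with hc
  have h1 : ∀ a b, D * s a b = ∑ i, c a i * s (u i) b := fun a b => by
    rw [hcross, sum_comm]
    simp [hc, sum_mul]
  have h2 : D ^ 2 * s a b = ∑ i, ∑ l, c a i * c b l * s (u l) (u i) := by
    calc D ^ 2 * s a b = D * (D * s a b) := by ring
      _ = ∑ i, c a i * (D * s b (u i)) := by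
        rw [h1, mul_sum]
        exact sum_congr rfl fun i _ => by rw [hsym b]; ring
      _ = _ := by
        refine sum_congr rfl fun i _ => ?_
        rw [h1, mul_sum]
        exact sum_congr rfl fun l _ => by ring
  have h3 : ∀ a b : W, ∑ l, (∑ i, c a i * r (u i) (u l)) * c b l =
      ∑ i, ∑ l, c a i * c b l * r (u i) (u l) := fun a b => by
    rw [sum_comm]
    refine sum_congr rfl fun l _ => ?_
    rw [sum_mul]
    exact sum_congr rfl fun i _ => by ring
  rw [h2, h3 a b, h3 b a, sum_comm (f := fun i l => c b i * c a l * r (u i) (u l)),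
    ← sum_add_distrib]
  refine sum_congr rfl fun i _ => ?_
  rw [← sum_add_distrib]
  exact sum_congr rfl fun l _ => by rw [hs]; ring

end LinearAlgebra

section SquarefreeCoefficients

open MvPolynomial

variable {k : ℕ} {V K : Type*} [AddCommGroup V] [CommRing K]

/-- The coefficient of the squarefree monomial `∏ i ∈ S, X i`. -/
noncomputable def sqfreeCoeff (S : Finset (Fin k)) : MvPolynomial (Fin k) K →+ K :=
  (lcoeff K (∑ i ∈ S, Finsupp.single i 1)).toAddMonoidHom

theorem sqfreeCoeff_apply (S : Finset (Fin k)) (F : MvPolynomial (Fin k) K) :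
    sqfreeCoeff S F = F.coeff (∑ i ∈ S, Finsupp.single i 1) := rfl

theorem sum_single_one_apply (S : Finset (Fin k)) (i : Fin k) :
    (∑ j ∈ S, Finsupp.single j 1 : Fin k →₀ ℕ) i = if i ∈ S then 1 else 0 := by
  simp [Finsupp.finsetSum_apply, Finsupp.single_apply]

theorem sqfreeCoeff_mul (S : Finset (Fin k)) (F G : MvPolynomial (Fin k) K) :
    sqfreeCoeff S (F * G) = ∑ B ∈ S.powerset, sqfreeCoeff B F * sqfreeCoeff (S \ B) G := by
  classical
  simp only [sqfreeCoeff_apply, coeff_mul]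
  symm
  refine sum_bij' (fun B _ => (∑ i ∈ B, Finsupp.single i 1, ∑ i ∈ S \ B, Finsupp.single i 1))
    (fun d _ => d.1.support) ?_ ?_ ?_ ?_ ?_
  · intro B hB
    rw [HasAntidiagonal.mem_antidiagonal, add_comm]
    exact sum_sdiff (mem_powerset.1 hB)
  · rintro ⟨a, b⟩ h
    rw [HasAntidiagonal.mem_antidiagonal] at h
    refine mem_powerset.2 fun i hi => ?_
    have := DFunLike.congr_fun h i
    rw [sum_single_one_apply, Finsupp.add_apply] at this
    have hi := Finsupp.mem_support_iff.1 hi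
    by_contra hS
    simp [hS] at this
    exact hi this.1
  · intro B _
    ext i
    simp only [Finsupp.mem_support_iff, sum_single_one_apply]
    simp
  · rintro ⟨a, b⟩ h
    rw [HasAntidiagonal.mem_antidiagonal] at h
    have H : ∀ i, a i + b i = if i ∈ S then 1 else 0 := fun i => by
      rw [← sum_single_one_apply, ← h, Finsupp.add_apply]
    ext i <;> have := H i <;> rw [sum_single_one_apply] <;>
      by_cases hS : i ∈ S <;> by_cases ha : a i = 0 <;> simp [hS, ha] at this ⊢ <;> omega
  · intro B _
    rfl

theorem sqfreeCoeff_C (S : Finset (Fin k)) (a : K) :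
    sqfreeCoeff S (C a) = if S = ∅ then a else 0 := by
  rw [sqfreeCoeff_apply, coeff_C]
  congr 1
  rw [eq_iff_iff]
  refine ⟨fun h => eq_empty_of_forall_notMem fun i hi => ?_, fun h => by simp [h]⟩
  have := DFunLike.congr_fun h i
  rw [sum_single_one_apply, if_pos hi] at this
  simp at this

theorem sqfreeCoeff_monomial (S : Finset (Fin k)) (i : Fin k) (a : K) :
    sqfreeCoeff S (monomial (Finsupp.single i 1) a) = if S = {i} then a else 0 := by
  rw [sqfreeCoeff_apply, coeff_monomial]
  congr 1
  rw [eq_iff_iff]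
  refine ⟨fun h => ?_, fun h => by simp [h]⟩
  ext l
  have := DFunLike.congr_fun h l
  rw [sum_single_one_apply, Finsupp.single_apply] at this
  rw [mem_singleton]
  split_ifs at this with h1 h2 h2 <;> (simp_all; try tauto)

/-- If `Δ` has no constant term then `Δ ^ j` contributes nothing to squarefree coefficients of
degree less than `j`. -/
theorem sqfreeCoeff_pow_mul_eq_zero {Δ : MvPolynomial (Fin k) K} (hΔ : sqfreeCoeff ∅ Δ = 0)
    (F : MvPolynomial (Fin k) K) (j : ℕ) :
    ∀ S : Finset (Fin k), S.card < j → sqfreeCoeff S (Δ ^ j * F) = 0 := by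
  induction j with
  | zero => intro S h; omega
  | succ j ih =>
    intro S h
    rw [pow_succ', mul_assoc, sqfreeCoeff_mul]
    refine sum_eq_zero fun B hB => ?_
    by_cases hB0 : B = ∅
    · rw [hB0, hΔ, zero_mul]
    · rw [ih, mul_zero]
      have := card_sdiff_add_card_eq_card (mem_powerset.1 hB)
      have := card_pos.2 (nonempty_iff_ne_empty.2 hB0)
      omega

/-- A polynomial inverse of `D` up to terms not contributing to squarefree coefficients. -/
noncomputable def truncInv {K : Type*} [Field K] (D : MvPolynomial (Fin k) K) :
    MvPolynomial (Fin k) K :=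
  C (sqfreeCoeff ∅ D)⁻¹ * ∑ j ∈ range (k + 1), (1 - C (sqfreeCoeff ∅ D)⁻¹ * D) ^ j

theorem sqfreeCoeff_truncInv_mul {K : Type*} [Field K] {D : MvPolynomial (Fin k) K}
    (hD : sqfreeCoeff ∅ D ≠ 0) (S : Finset (Fin k)) (F : MvPolynomial (Fin k) K) :
    sqfreeCoeff S (truncInv D * (D * F)) = sqfreeCoeff S F := by
  set d := sqfreeCoeff ∅ D with hd
  have h1 : truncInv D * (D * F) = F - (1 - C d⁻¹ * D) ^ (k + 1) * F := by
    have := geom_sum_mul_neg (1 - C d⁻¹ * D) (k + 1)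
    rw [sub_sub_cancel] at this
    rw [truncInv, ← hd]
    linear_combination F * this
  rw [h1, map_sub, sqfreeCoeff_pow_mul_eq_zero, sub_zero]
  · rw [map_sub, sqfreeCoeff_mul, ← C_1, sqfreeCoeff_C]
    simp [sqfreeCoeff_C, ← hd, hD]
  · exact Nat.lt_succ_of_le (S.card_le_univ.trans (by simp))

end SquarefreeCoefficients

section SqfreeAdditive

open MvPolynomial

variable {k : ℕ} {V K : Type*} [AddCommGroup V] [CommRing K] {R T T' : Finset (Fin k)}

/-- The squarefree coefficients of `F` supported on `S ⊆ R` are additive in the variables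
`S ∪ T`. -/
def SqfreeAdditive (R T : Finset (Fin k)) (F : (Fin k → V) → MvPolynomial (Fin k) K) : Prop :=
  ∀ S ⊆ R, AdditiveOn (S ∪ T) fun x => sqfreeCoeff S (F x)

namespace SqfreeAdditive

theorem sum {ι : Type*} (s : Finset ι) {F : ι → (Fin k → V) → MvPolynomial (Fin k) K}
    (hF : ∀ a ∈ s, SqfreeAdditive R T (F a)) : SqfreeAdditive R T fun x => ∑ a ∈ s, F a x := by
  intro S hS
  simp only [map_sum]
  exact AdditiveOn.sum s fun a ha => hF a ha S hS

theorem mul {F G : (Fin k → V) → MvPolynomial (Fin k) K} (hF : SqfreeAdditive R T F)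
    (hG : SqfreeAdditive R T' G) (hR : Disjoint R T) (hR' : Disjoint R T') (hT : Disjoint T T') :
    SqfreeAdditive R (T ∪ T') fun x => F x * G x := by
  intro S hS
  simp only [sqfreeCoeff_mul]
  refine AdditiveOn.sum _ fun B hB => ?_
  have hB := mem_powerset.1 hB
  have h := (hF B (hB.trans hS)).mul (hG (S \ B) (sdiff_subset.trans hS)) ?_
  · rwa [union_union_union_comm, union_sdiff_of_subset hB] at h
  · simp only [disjoint_union_left, disjoint_union_right]
    exact ⟨⟨disjoint_sdiff, (hR.mono_left (sdiff_subset.trans hS)).symm⟩,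
      hR'.mono_left (hB.trans hS), hT⟩

theorem C_comp {g : (Fin k → V) → K} (hg : AdditiveOn T g) :
    SqfreeAdditive R T fun x => C (g x) := by
  intro S _
  simp only [sqfreeCoeff_C]
  split_ifs with h
  · rwa [h, empty_union]
  · exact AdditiveOn.zero

theorem monomial_comp {i : Fin k} {g : (Fin k → V) → K} (hg : AdditiveOn {i} g) :
    SqfreeAdditive R ∅ fun x => monomial (Finsupp.single i 1) (g x) := by
  intro S _
  simp only [sqfreeCoeff_monomial]
  split_ifs with h
  · rwa [h, union_empty]
  · exact AdditiveOn.zero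

end SqfreeAdditive

/-- The functions of `k` vectors whose squarefree coefficient of `∏ i ∈ S, X i`, for `S ⊆ R`, is
multilinear in the variables `S`. -/
def sqfreeSubring (V K : Type*) [AddCommGroup V] [CommRing K] (R : Finset (Fin k)) :
    Subring ((Fin k → V) → MvPolynomial (Fin k) K) where
  carrier := {F | SqfreeAdditive R ∅ F}
  mul_mem' hF hG := by
    have := hF.mul hG (disjoint_empty_right _) (disjoint_empty_right _) (disjoint_empty_right _)
    rwa [union_empty] at this
  one_mem' := by
    have := SqfreeAdditive.C_comp (R := R) (AdditiveOn.const (k := k) (V := V) (1 : K))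
    simp only [C_1] at this
    exact this
  add_mem' {F G} hF hG S hS := by
    simp only [Pi.add_apply, map_add]
    exact (hF S hS).add (hG S hS)
  zero_mem' S hS := by
    simp only [Pi.zero_apply, map_zero]
    exact AdditiveOn.zero
  neg_mem' {F} hF S hS := by
    simp only [Pi.neg_apply, map_neg]
    exact (hF S hS).comp_addHom (-AddMonoidHom.id K)

theorem C_mem_sqfreeSubring (a : K) : (fun _ => C a) ∈ sqfreeSubring V K R :=
  SqfreeAdditive.C_comp (AdditiveOn.const a)

theorem det_mem_sqfreeSubring {r : ℕ}
    {M : (Fin k → V) → Matrix (Fin r) (Fin r) (MvPolynomial (Fin k) K)}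
    (hM : ∀ i j, (fun x => M x i j) ∈ sqfreeSubring V K R) :
    (fun x => (M x).det) ∈ sqfreeSubring V K R := by
  have : (fun x => (M x).det) =
      ∑ π : Equiv.Perm (Fin r), Equiv.Perm.sign π • ∏ i, fun x => M x (π i) i := by
    ext1 x
    simp [Matrix.det_apply, Finset.sum_apply, Finset.prod_apply]
  rw [this]
  refine sum_mem fun π _ => ?_
  rw [Units.smul_def]
  exact zsmul_mem (prod_mem fun i _ => hM _ _) _

theorem adjugate_mem_sqfreeSubring {r : ℕ}
    {M : (Fin k → V) → Matrix (Fin r) (Fin r) (MvPolynomial (Fin k) K)}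
    (hM : ∀ i j, (fun x => M x i j) ∈ sqfreeSubring V K R) (i j : Fin r) :
    (fun x => (M x).adjugate i j) ∈ sqfreeSubring V K R := by
  simp only [Matrix.adjugate_apply]
  refine det_mem_sqfreeSubring fun a b => ?_
  simp only [Matrix.updateRow_apply]
  split_ifs with h
  · by_cases hb : i = b
    · subst hb
      simp only [Pi.single_eq_same]
      exact one_mem (sqfreeSubring V K R)
    · simp only [Pi.single_apply, if_neg (Ne.symm hb)]
      exact zero_mem (sqfreeSubring V K R)
  · exact hM a b

theorem truncInv_mem_sqfreeSubring {K : Type*} [Field K] {D : (Fin k → V) → MvPolynomial (Fin k) K}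
    (hD : D ∈ sqfreeSubring V K R) : (fun x => truncInv (D x)) ∈ sqfreeSubring V K R := by
  have h0 : ∀ x, sqfreeCoeff ∅ (D x) = sqfreeCoeff ∅ (D 0) := fun x =>
    (hD ∅ (empty_subset _)).1 x 0 fun i hi => by simp at hi
  have e : (fun x => truncInv (D x)) = (fun _ => C (sqfreeCoeff ∅ (D 0))⁻¹) *
      ∑ j ∈ range (k + 1), (1 - (fun _ => C (sqfreeCoeff ∅ (D 0))⁻¹) * D) ^ j := by
    ext1 x
    simp [truncInv, h0 x, Finset.sum_apply]
  rw [e]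
  exact mul_mem (C_mem_sqfreeSubring _) (sum_mem fun j _ =>
    pow_mem (sub_mem (one_mem _) (mul_mem (C_mem_sqfreeSubring _) hD)) j)

end SqfreeAdditive

section Shift

open MvPolynomial

variable {k n : ℕ} {K : Type*} [Field K]

theorem AdditiveOn.apply {V M : Type*} [AddCommGroup V] [AddCommMonoid M] (φ : V →+ M)
    (i : Fin k) : AdditiveOn {i} fun x : Fin k → V => φ (x i) := by
  refine ⟨fun x y h => by simp only [h i (mem_singleton_self i)], fun j hj x u v => ?_⟩
  rw [mem_singleton] at hj
  subst hj
  simp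

theorem sqfreeCoeff_linear_mul (i : Fin k) (a b : K) (P : MvPolynomial (Fin k) K)
    (S : Finset (Fin k)) : sqfreeCoeff S ((C a + monomial (Finsupp.single i 1) b) * P) =
      a * sqfreeCoeff S P + if i ∈ S then b * sqfreeCoeff (S.erase i) P else 0 := by
  rw [add_mul, map_add, sqfreeCoeff_mul, sqfreeCoeff_mul]
  congr 1
  · rw [sum_eq_single ∅] <;> simp +contextual [sqfreeCoeff_C]
  · split_ifs with h
    · rw [sum_eq_single {i}] <;> simp +contextual [sqfreeCoeff_monomial, h, sdiff_singleton_eq_erase]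
    · refine sum_eq_zero fun B hB => ?_
      rw [sqfreeCoeff_monomial, if_neg, zero_mul]
      rintro rfl
      exact h (by simpa using hB)

theorem sqfreeCoeff_prod_linear (R : Finset (Fin k)) (a b : Fin k → K) :
    sqfreeCoeff R (∏ i, if i ∈ R then C (a i) + monomial (Finsupp.single i 1) (b i)
      else C (b i)) = ∏ i, b i := by
  suffices H : ∀ s : Finset (Fin k), (∀ S, ¬ S ⊆ s → sqfreeCoeff S (∏ i ∈ s, if i ∈ R then
      C (a i) + monomial (Finsupp.single i 1) (b i) else C (b i)) = 0) ∧
      sqfreeCoeff (R ∩ s) (∏ i ∈ s, if i ∈ R then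
      C (a i) + monomial (Finsupp.single i 1) (b i) else C (b i)) = ∏ i ∈ s, b i by
    simpa using (H univ).2
  intro s
  induction s using Finset.induction_on with
  | empty =>
    refine ⟨fun S hS => ?_, ?_⟩
    · rw [prod_empty, ← C_1, sqfreeCoeff_C, if_neg]
      rintro rfl
      simp at hS
    · rw [prod_empty, ← C_1, sqfreeCoeff_C]
      simp
  | insert i s hi ih =>
    rw [prod_insert hi, prod_insert hi]
    have hC : ∀ c : K, (C c : MvPolynomial (Fin k) K) =
        C c + monomial (Finsupp.single i 1) 0 := by simp
    refine ⟨fun S hS => ?_, ?_⟩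
    · have h1 : ¬ S ⊆ s := fun h => hS (h.trans (subset_insert _ _))
      have h2 : ¬ S.erase i ⊆ s := fun h => hS (subset_insert_iff.2 h)
      split_ifs with hR
      · rw [sqfreeCoeff_linear_mul, ih.1 _ h1, ih.1 _ h2]
        simp
      · rw [hC, sqfreeCoeff_linear_mul, ih.1 _ h1]
        simp
    · split_ifs with hR
      · have h1 : ¬ R ∩ insert i s ⊆ s := fun h => hi (h (by simp [hR]))
        have h2 : (R ∩ insert i s).erase i = R ∩ s := by
          ext j
          by_cases hj : j = i
          · subst hj; simp [hi]
          · simp [hj]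
        rw [sqfreeCoeff_linear_mul, ih.1 _ h1, h2, ih.2, if_pos (by simp [hR])]
        simp
      · rw [hC, sqfreeCoeff_linear_mul, inter_insert_of_notMem hR, ih.2]
        simp

variable [Algebra (ZMod 2) K]

/-- The line through `z` in the direction `x`, with an independent parameter in each of the `k`
coordinates. -/
noncomputable def shift (z : Fin k → Fin n → K) (x : Fin k → Fin n → ZMod 2) :
    Fin k → Fin n → MvPolynomial (Fin k) K :=
  fun i t => C (z i t) + monomial (Finsupp.single i 1) (algebraMap (ZMod 2) K (x i t))

variable {p q : Fin k} {R : Finset (Fin k)}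

theorem algebraMap_eq_C_algebraMap (c : ZMod 2) :
    algebraMap (ZMod 2) (MvPolynomial (Fin k) K) c = C (algebraMap (ZMod 2) K c) := rfl

theorem additiveOn_algebraMap_apply (i : Fin k) (t : Fin n) :
    AdditiveOn {i} fun x : Fin k → Fin n → ZMod 2 => algebraMap (ZMod 2) K (x i t) :=
  AdditiveOn.apply ((algebraMap (ZMod 2) K).toAddMonoidHom.comp (Pi.evalAddMonoidHom (fun _ : Fin n => ZMod 2) t)) i

theorem shift_mem_sqfreeSubring (z : Fin k → Fin n → K) (i : Fin k) (t : Fin n) :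
    (fun x => shift z x i t) ∈ sqfreeSubring (Fin n → ZMod 2) K R :=
  add_mem (C_mem_sqfreeSubring _)
    (SqfreeAdditive.monomial_comp (additiveOn_algebraMap_apply (K := K) i t))

theorem bilinSlice_shift_mem (f : (Fin k → Fin n → ZMod 2) → ZMod 2) (z : Fin k → Fin n → K)
    (a b : Fin n → ZMod 2) : (fun x => bilinSlice p q f (shift z x) a b) ∈
      sqfreeSubring (Fin n → ZMod 2) K R := by
  have e : (fun x => bilinSlice p q f (shift z x) a b) =
      ∑ j : Fin k → Fin n, (fun _ => C (algebraMap (ZMod 2) K (f fun i => Pi.single (j i) 1))) *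
      ∏ i, fun x => Function.update (Function.update (shift z x) p fun t =>
        algebraMap (ZMod 2) (MvPolynomial (Fin k) K) (a t)) q
        (fun t => algebraMap (ZMod 2) _ (b t)) i (j i) := by
    ext1 x
    simp [bilinSlice, scalarExt, Finset.sum_apply, Finset.prod_apply]
  rw [e]
  refine sum_mem fun j _ => mul_mem (C_mem_sqfreeSubring _) (prod_mem fun i _ => ?_)
  by_cases hq : i = q
  · subst hq
    simp only [Function.update_self]
    exact C_mem_sqfreeSubring _
  · by_cases hp : i = p
    · subst hp
      simp only [Function.update_of_ne hq, Function.update_self]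
      exact C_mem_sqfreeSubring _
    · simp only [Function.update_of_ne hq, Function.update_of_ne hp]
      exact shift_mem_sqfreeSubring z i (j i)

theorem bilinSlice_shift_sqfreeAdditive (hpq : p ≠ q) (f : (Fin k → Fin n → ZMod 2) → ZMod 2)
    (z : Fin k → Fin n → K) {e : Fin k} (he : e ∉ R) (b : Fin n → ZMod 2) :
    SqfreeAdditive R {e} fun x => bilinSlice p q f (shift z x) (x e) b := by
  have H : (fun x => bilinSlice p q f (shift z x) (x e) b) = fun x =>
      ∑ j : Fin k → Fin n, C (algebraMap (ZMod 2) K (x e (j p))) *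
        (C (algebraMap (ZMod 2) K (f fun i => Pi.single (j i) 1)) *
      ∏ i ∈ univ.erase p, Function.update (shift z x) q
        (fun t => algebraMap (ZMod 2) _ (b t)) i (j i)) := by
    ext1 x
    rw [bilinSlice, scalarExt]
    refine sum_congr rfl fun j _ => ?_
    rw [← mul_prod_erase _ _ (mem_univ p), Function.update_of_ne hpq, Function.update_self,
      mul_left_comm]
    congr 2
    refine prod_congr rfl fun i hi => ?_
    rw [Function.update_comm hpq, Function.update_of_ne (ne_of_mem_erase hi)]
  rw [H]
  refine SqfreeAdditive.sum _ fun j _ => ?_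
  have h := (SqfreeAdditive.C_comp (R := R) (additiveOn_algebraMap_apply (K := K) e (j p))).mul
    (G := (fun _ => C (algebraMap (ZMod 2) K (f fun i => Pi.single (j i) 1))) *
      ∏ i ∈ univ.erase p, fun x => Function.update (shift z x) q
        (fun t => algebraMap (ZMod 2) _ (b t)) i (j i)) (T' := ∅)
    (mul_mem (S := Subring _) (s := sqfreeSubring (Fin n → ZMod 2) K R) (C_mem_sqfreeSubring _)
      (prod_mem fun i hi => ?_)) (disjoint_singleton_right.2 he) (disjoint_empty_right _)
    (disjoint_empty_right _)
  · rw [union_empty] at h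
    convert h using 2 with x
    simp
  · by_cases hq : i = q
    · subst hq
      simp only [Function.update_self]
      exact C_mem_sqfreeSubring _
    · simp only [Function.update_of_ne hq]
      exact shift_mem_sqfreeSubring z i (j i)

theorem bilinSlice_congr {A : Type*} [CommRing A] [Algebra (ZMod 2) A]
    (f : (Fin k → Fin n → ZMod 2) → ZMod 2) {ζ ζ' : Fin k → Fin n → A}
    (h : ∀ i, i ≠ p → i ≠ q → ζ i = ζ' i) : bilinSlice p q f ζ = bilinSlice p q f ζ' := by
  ext a b
  rw [bilinSlice, bilinSlice]
  congr 1
  ext1 i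
  by_cases hq : i = q
  · subst hq; simp
  · by_cases hp : i = p
    · subst hp; simp [hq]
    · simp [hp, hq, h]

/-- Expansion of a multilinear form in the standard basis. -/
theorem AdditiveOn.eq_sum {f : (Fin k → Fin n → ZMod 2) → ZMod 2} (hf : AdditiveOn univ f)
    (x : Fin k → Fin n → ZMod 2) :
    f x = ∑ j : Fin k → Fin n, f (fun i => Pi.single (j i) 1) * ∏ i, x i (j i) := by
  have hsmul : ∀ (m : Fin k → Fin n → ZMod 2) i (c : ZMod 2) u,
      f (Function.update m i (c • u)) = c • f (Function.update m i u) := fun m i =>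
    ZMod.map_smul (AddMonoidHom.mk' (fun u => f (Function.update m i u)) (hf.2 i (mem_univ i) m))
  let F : MultilinearMap (ZMod 2) (fun _ : Fin k => Fin n → ZMod 2) (ZMod 2) :=
    { toFun := f
      map_update_add' := fun {inst} m i u v => by
        rw [Subsingleton.elim inst (instDecidableEqFin k)]
        exact hf.2 i (mem_univ i) m u v
      map_update_smul' := fun {inst} m i c u => by
        rw [Subsingleton.elim inst (instDecidableEqFin k)]
        exact hsmul m i c u }
  have h1 : x = fun i => ∑ t, x i t • (Pi.single t 1 : Fin n → ZMod 2) := by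
    ext i t
    simp [Finset.sum_apply, Pi.single_apply]
  have h2 := F.map_sum (fun i t => x i t • (Pi.single t 1 : Fin n → ZMod 2))
  rw [← h1] at h2
  refine h2.trans (sum_congr rfl fun j _ => ?_)
  rw [F.map_smul_univ, smul_eq_mul, mul_comm]
  rfl

theorem sqfreeCoeff_bilinSlice_shift (hpq : p ≠ q) {f : (Fin k → Fin n → ZMod 2) → ZMod 2}
    (hf : AdditiveOn univ f) (z : Fin k → Fin n → K) (x : Fin k → Fin n → ZMod 2) :
    sqfreeCoeff (univ \ {p, q}) (bilinSlice p q f (shift z x) (x p) (x q)) =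
      algebraMap (ZMod 2) K (f x) := by
  rw [hf.eq_sum x, bilinSlice, scalarExt, map_sum, map_sum]
  refine sum_congr rfl fun j _ => ?_
  rw [map_mul (algebraMap (ZMod 2) K), map_prod (algebraMap (ZMod 2) K), ← sqfreeCoeff_prod_linear (univ \ {p, q}) (fun i => z i (j i)),
    algebraMap_eq_C_algebraMap, ← smul_eq_C_mul, sqfreeCoeff_apply, coeff_smul, smul_eq_mul,
    sqfreeCoeff_apply]
  congr 3
  ext1 i
  by_cases hq : i = q
  · subst hq; simp
  · by_cases hp : i = p
    · subst hp; simp [hq]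
    · simp [hp, hq, shift]

end Shift

section MaximalMinor

open MvPolynomial

variable {k n : ℕ} {K : Type*} [Field K]

theorem degreeOf_det_le {ι : Type*} [Fintype ι] [DecidableEq ι] {d : ℕ} (l : Fin k)
    {M : Matrix ι ι (MvPolynomial (Fin k) K)} (h : ∀ i j, degreeOf l (M i j) ≤ d) :
    degreeOf l M.det ≤ Fintype.card ι * d := by
  rw [Matrix.det_apply]
  refine (degreeOf_sum_le _ _ _).trans (Finset.sup_le fun π _ => ?_)
  have h1 : degreeOf l (∏ i, M (π i) i) ≤ Fintype.card ι * d := by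
    refine (degreeOf_prod_le _ _ _).trans ((sum_le_card_nsmul _ _ d fun i _ => h _ _).trans ?_)
    simp
  rcases Int.units_eq_one_or (Equiv.Perm.sign π) with e | e
  · simpa [e] using h1
  · simpa [e] using h1

variable [Algebra (ZMod 2) K] {p q : Fin k}

theorem degreeOf_bilinSlice_shift_le (f : (Fin k → Fin n → ZMod 2) → ZMod 2)
    (z : Fin k → Fin n → K) (x : Fin k → Fin n → ZMod 2) (a b : Fin n → ZMod 2) (l : Fin k) :
    degreeOf l (bilinSlice p q f (shift z x) a b) ≤ 1 := by
  rw [bilinSlice, scalarExt]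
  refine (degreeOf_sum_le _ _ _).trans (Finset.sup_le fun j _ => ?_)
  refine (degreeOf_mul_le _ _ _).trans ?_
  rw [algebraMap_eq_C_algebraMap, degreeOf_C, zero_add]
  refine (degreeOf_prod_le _ _ _).trans ?_
  calc _ ≤ ∑ i : Fin k, if i = l then 1 else 0 := sum_le_sum fun i _ => ?_
    _ = 1 := by simp
  by_cases hq : i = q
  · subst hq
    rw [Function.update_self, algebraMap_eq_C_algebraMap, degreeOf_C]
    exact Nat.zero_le _
  by_cases hp : i = p
  · subst hp
    rw [Function.update_of_ne hq, Function.update_self, algebraMap_eq_C_algebraMap, degreeOf_C]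
    exact Nat.zero_le _
  rw [Function.update_of_ne hq, Function.update_of_ne hp, shift]
  refine (degreeOf_add_le _ _ _).trans (max_le (by simp [degreeOf_C]) ?_)
  rw [degreeOf_le_iff]
  intro m hm
  have := support_monomial_subset hm
  rw [mem_singleton] at this
  rw [this, Finsupp.single_apply]

/-- A maximal nonvanishing minor among all slices over `K`. -/
theorem exists_maximal_minor (hpq : p ≠ q) {N : ℕ} {σ : (Fin k → Fin n → ZMod 2) → ZMod 2}
    (h : SumOf (SplitForm p q ∅) N σ) :
    ∃ r ≤ N, ∃ (z : Fin k → Fin n → K) (u v : Fin r → Fin n → ZMod 2),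
      (Matrix.of fun i j => bilinSlice p q σ z (u i) (v j)).det ≠ 0 ∧
      ∀ (z : Fin k → Fin n → K) (u v : Fin r ⊕ Unit → Fin n → ZMod 2),
        (Matrix.of fun i j => bilinSlice p q σ z (u i) (v j)).det = 0 := by
  classical
  let Q : ℕ → Prop := fun r => ∃ (z : Fin k → Fin n → K) (u v : Fin r → Fin n → ZMod 2),
      (Matrix.of fun i j => bilinSlice p q σ z (u i) (v j)).det ≠ 0
  have hQ : ∀ r, Q r → r ≤ N := by
    rintro r ⟨z, u, v, hdet⟩
    have h1 := rank_bilinSlice_le hpq h z u v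
    rwa [Matrix.rank_of_isUnit _ ((Matrix.isUnit_iff_isUnit_det _).2 (isUnit_iff_ne_zero.2 hdet)),
      Fintype.card_fin] at h1
  have hQ0 : Q 0 := ⟨0, Fin.elim0, Fin.elim0, by simp⟩
  have hex : ∃ r, ¬ Q (r + 1) := ⟨N, fun h => by have := hQ _ h; omega⟩
  have hr : Q (Nat.find hex) := by
    rcases hm : Nat.find hex with _ | m
    · exact hQ0
    · exact not_not.1 (Nat.find_min hex (m := m) (by omega))
  obtain ⟨z, u, v, hdet⟩ := hr
  refine ⟨Nat.find hex, hQ _ ⟨z, u, v, hdet⟩, z, u, v, hdet, fun z' u' v' => ?_⟩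
  by_contra hne
  let e : Fin (Nat.find hex + 1) ≃ Fin (Nat.find hex) ⊕ Unit :=
    Fintype.equivOfCardEq (by simp)
  refine Nat.find_spec hex ⟨z', u' ∘ e, v' ∘ e, ?_⟩
  rw [← Matrix.det_submatrix_equiv_self e] at hne
  exact hne

/-- Along the lines `shift z x` the maximal minor determines the whole bilinear form. -/
theorem det_mul_bilinSlice_shift [Fintype K] {r : ℕ} (hr : r + 1 < Fintype.card K)
    {σ : (Fin k → Fin n → ZMod 2) → ZMod 2}
    (hzero : ∀ (z : Fin k → Fin n → K) (u v : Fin r ⊕ Unit → Fin n → ZMod 2),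
      (Matrix.of fun i j => bilinSlice p q σ z (u i) (v j)).det = 0)
    (z : Fin k → Fin n → K) (u v : Fin r → Fin n → ZMod 2) (x : Fin k → Fin n → ZMod 2)
    (hM : (Matrix.of fun i j => bilinSlice p q σ (shift z x) (u i) (v j)).det ≠ 0)
    (a b : Fin n → ZMod 2) :
    (Matrix.of fun i j => bilinSlice p q σ (shift z x) (u i) (v j)).det *
        bilinSlice p q σ (shift z x) a b =
      ∑ j, ∑ i, bilinSlice p q σ (shift z x) a (v j) *
        (Matrix.of fun i j => bilinSlice p q σ (shift z x) (u i) (v j)).adjugate j i *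
        bilinSlice p q σ (shift z x) (u i) b := by
  refine det_mul_eq_of_det_bordered_eq_zero hM
    (fun i => bilinSlice p q σ (shift z x) (u i) b)
    (fun j => bilinSlice p q σ (shift z x) a (v j)) _ ?_
  have e : Matrix.fromBlocks (Matrix.of fun i j => bilinSlice p q σ (shift z x) (u i) (v j))
      (Matrix.replicateCol Unit fun i => bilinSlice p q σ (shift z x) (u i) b)
      (Matrix.replicateRow Unit fun j => bilinSlice p q σ (shift z x) a (v j))
      (Matrix.of fun _ _ => bilinSlice p q σ (shift z x) a b) =
      Matrix.of fun i j => bilinSlice p q σ (shift z x) (Sum.elim u (fun _ => a) i)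
        (Sum.elim v (fun _ => b) j) := by
    ext (i | i) (j | j) <;> rfl
  rw [e]
  refine eq_zero_of_eval_zero_at_prod_finset _ (fun _ => univ) (fun l => ?_) fun t _ => ?_
  · refine (degreeOf_det_le l (d := 1) fun i j =>
      degreeOf_bilinSlice_shift_le σ z x _ _ l).trans_lt ?_
    simpa using hr
  · rw [RingHom.map_det]
    convert hzero (fun i s => eval t (shift z x i s)) (Sum.elim u fun _ => a) (Sum.elim v fun _ => b)
      using 2
    ext i j
    exact map_bilinSlice (eval t) _ _ _ _

theorem sqfreeCoeff_empty_det_shift {r : ℕ} (σ : (Fin k → Fin n → ZMod 2) → ZMod 2)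
    (z : Fin k → Fin n → K) (u v : Fin r → Fin n → ZMod 2) (x : Fin k → Fin n → ZMod 2) :
    sqfreeCoeff ∅ (Matrix.of fun i j => bilinSlice p q σ (shift z x) (u i) (v j)).det =
      (Matrix.of fun i j => bilinSlice p q σ z (u i) (v j)).det := by
  have h : ∀ F : MvPolynomial (Fin k) K, sqfreeCoeff ∅ F = constantCoeff F := fun F => by
    rw [sqfreeCoeff_apply, sum_empty]; rfl
  rw [h, RingHom.map_det]
  congr 1
  ext i j
  rw [RingHom.mapMatrix_apply, Matrix.map_apply, Matrix.of_apply, Matrix.of_apply, map_bilinSlice]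
  congr 1
  ext l t
  simp [shift, constantCoeff_monomial]

end MaximalMinor

section SplitForms

open MvPolynomial

variable {k n : ℕ} {p q : Fin k}

theorem sumOf_productForm_sqfreeCoeff_mul {V K : Type*} [AddCommGroup V] [Field K]
    [Algebra (ZMod 2) K] [Module.Finite (ZMod 2) K] (hpq : p ≠ q) (φ : K →ₗ[ZMod 2] ZMod 2)
    {F G : (Fin k → V) → MvPolynomial (Fin k) K} (hF : SqfreeAdditive (univ \ {p, q}) {p} F)
    (hG : SqfreeAdditive (univ \ {p, q}) {q} G) :
    SumOf ProductForm (2 ^ k * Module.finrank (ZMod 2) K)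
      fun x => φ (sqfreeCoeff (univ \ {p, q}) (F x * G x)) := by
  set R : Finset (Fin k) := univ \ {p, q} with hR
  let b := Module.finBasis (ZMod 2) K
  have e : (fun x => φ (sqfreeCoeff R (F x * G x))) = ∑ B ∈ R.powerset, ∑ i,
      (fun x => b.coord i (sqfreeCoeff B (F x))) *
        fun x => φ (b i * sqfreeCoeff (R \ B) (G x)) := by
    ext1 x
    simp only [Finset.sum_apply, Pi.mul_apply, sqfreeCoeff_mul, map_sum]
    refine sum_congr rfl fun B _ => ?_
    conv_lhs => rw [← b.sum_repr (sqfreeCoeff B (F x))]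
    simp only [sum_mul, smul_mul_assoc, map_sum, map_smul, smul_eq_mul, Module.Basis.coord_apply]
  rw [e]
  refine SumOf.mono (SumOf.sum (N := Module.finrank (ZMod 2) K) _ fun B hB => ?_) (fun _ => id)
    (Nat.mul_le_mul_right _ ?_)
  · rw [mem_powerset] at hB
    refine (SumOf.sum (P := ProductForm) univ fun i _ => SumOf.single
      ⟨(R \ B) ∪ {q}, _, _, ?_, ?_, ?_, ?_, rfl⟩).mono (fun _ => id) (by simp)
    · simp
    · intro h
      have : p ∈ (R \ B) ∪ {q} := h ▸ mem_univ p
      simp [hR, hpq] at this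
    · have hc : ((R \ B) ∪ {q})ᶜ = B ∪ {p} := by
        ext i
        by_cases hp : i = p
        · subst hp; simp [hR, hpq]
        · by_cases hq : i = q
          · subst hq
            have : i ∉ B := fun h => by simpa [hR] using hB h
            simp [this, hp]
          · simp [hR, hp, hq]
      rw [hc]
      exact (hF B hB).comp_addHom (b.coord i).toAddMonoidHom
    · exact (hG (R \ B) sdiff_subset).comp_addHom
        (φ.toAddMonoidHom.comp (AddMonoidHom.mulLeft (b i)))
  · rw [card_powerset]
    exact Nat.pow_le_pow_right two_pos (R.card_le_univ.trans (by simp))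

/-- A symmetrization which is a sum of products separating `p` from `q` is the symmetrization of a
form of small partition rank. -/
theorem symmetrizable_of_splitForm (hpq : p ≠ q) {N : ℕ} {σ : (Fin k → Fin n → ZMod 2) → ZMod 2}
    (hσ : IsSymmetrization p q σ) (h : SumOf (SplitForm p q ∅) N σ) :
    Symmetrizable p q (N * (2 ^ k * (N + 2))) σ := by
  classical
  obtain ⟨ρ, hρ, hσρ⟩ := hσ
  have hσadd : AdditiveOn univ σ := by
    rw [hσρ]
    exact hρ.add (hρ.perm _)
  let K := GaloisField 2 (N + 2)
  have : Fintype K := Fintype.ofFinite K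
  have hcard : Fintype.card K = 2 ^ (N + 2) := by
    rw [← Nat.card_eq_fintype_card]
    exact GaloisField.card 2 (N + 2) (by omega)
  have hfin : Module.finrank (ZMod 2) K = N + 2 := GaloisField.finrank 2 (by omega)
  obtain ⟨φ, hφ⟩ := LinearMap.exists_leftInverse_of_injective (Algebra.linearMap (ZMod 2) K)
    (LinearMap.ker_eq_bot.2 (algebraMap (ZMod 2) K).injective)
  replace hφ : ∀ c, φ (algebraMap (ZMod 2) K c) = c := fun c => LinearMap.congr_fun hφ c
  obtain ⟨r, hr, z, u, v, hdet, hzero⟩ := exists_maximal_minor (K := K) hpq h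
  let R : Finset (Fin k) := univ \ {p, q}
  let s := fun x => bilinSlice p q σ (shift z x)
  let τ := fun x => bilinSlice p q ρ (shift z x)
  let M := fun x => Matrix.of fun i j => s x (u i) (v j)
  let D := fun x => (M x).det
  let c := fun x a l => ∑ j, s x a (v j) * (M x).adjugate j l
  let W := fun x a b => ∑ l, (∑ i, c x a i * τ x (u i) (u l)) * c x b l
  have hs : ∀ x a b, s x a b = τ x a b + τ x b a := fun x a b => by
    simp only [s, τ]
    rw [← bilinSlice_add_permForm hpq, ← hσρ]
  have hD0 : ∀ x, sqfreeCoeff ∅ (D x) ≠ 0 := fun x => by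
    simp only [D, M, s]
    rw [sqfreeCoeff_empty_det_shift]
    exact hdet
  have hD20 : ∀ x, sqfreeCoeff ∅ (D x ^ 2) ≠ 0 := fun x => by
    rw [sq, sqfreeCoeff_mul]
    simpa using hD0 x
  have hcross : ∀ x a b, D x * s x a b =
      ∑ j, ∑ i, s x a (v j) * (M x).adjugate j i * s x (u i) b := fun x =>
    det_mul_bilinSlice_shift (by rw [hcard]; have := (N + 2).lt_two_pow_self; omega) hzero z u v x
      fun h0 => hD0 x (by simp only [D, M, s]; rw [h0, map_zero])
  have hW : ∀ x a b, D x ^ 2 * s x a b = W x a b + W x b a := fun x =>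
    det_sq_mul_eq_symmetrization (hs x) (hcross x)
  have hsmem : ∀ a b, (fun x => s x a b) ∈ sqfreeSubring (Fin n → ZMod 2) K R := fun a b =>
    bilinSlice_shift_mem σ z a b
  have hτmem : ∀ a b, (fun x => τ x a b) ∈ sqfreeSubring (Fin n → ZMod 2) K R := fun a b =>
    bilinSlice_shift_mem ρ z a b
  have hadj : ∀ i j, (fun x => (M x).adjugate i j) ∈ sqfreeSubring (Fin n → ZMod 2) K R :=
    adjugate_mem_sqfreeSubring fun i j => hsmem (u i) (v j)
  have hD : (fun x => D x) ∈ sqfreeSubring (Fin n → ZMod 2) K R :=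
    det_mem_sqfreeSubring fun i j => hsmem (u i) (v j)
  have hE : (fun x => truncInv (D x ^ 2)) ∈ sqfreeSubring (Fin n → ZMod 2) K R :=
    truncInv_mem_sqfreeSubring (D := fun x => D x ^ 2) (pow_mem hD 2)
  have hmul : ∀ {e : Fin k}, e ∉ R → ∀ {F G : (Fin k → Fin n → ZMod 2) → MvPolynomial (Fin k) K},
      SqfreeAdditive R {e} F → G ∈ sqfreeSubring (Fin n → ZMod 2) K R →
      SqfreeAdditive R {e} fun x => F x * G x := fun he F G hF hG => by
    have := hF.mul hG (disjoint_singleton_right.2 he) (disjoint_empty_right _)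
      (disjoint_empty_right _)
    rwa [union_empty] at this
  have hc : ∀ e, e ∉ R → ∀ l, SqfreeAdditive R {e} fun x => c x (x e) l := fun e he l =>
    SqfreeAdditive.sum _ fun j _ =>
      hmul he (bilinSlice_shift_sqfreeAdditive hpq σ z he (v j)) (hadj j l)
  have hpR : p ∉ R := by simp [R]
  have hqR : q ∉ R := by simp [R]
  let β : (Fin k → Fin n → ZMod 2) → ZMod 2 := fun x =>
    φ (sqfreeCoeff R (truncInv (D x ^ 2) * W x (x p) (x q)))
  refine ⟨β, ?_, ?_⟩
  · have e : β = ∑ l, fun x => φ (sqfreeCoeff R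
        ((∑ i, c x (x p) i * τ x (u i) (u l)) * truncInv (D x ^ 2) * c x (x q) l)) := by
      ext1 x
      simp only [β, W, Finset.sum_apply, mul_sum, map_sum]
      refine sum_congr rfl fun l _ => ?_
      congr 2
      ring
    rw [e]
    refine (SumOf.sum (P := ProductForm) univ fun l _ =>
      sumOf_productForm_sqfreeCoeff_mul hpq φ ?_ (hc q hqR l)).mono (fun _ => id) ?_
    · exact hmul hpR (SqfreeAdditive.sum _ fun i _ => hmul hpR (hc p hpR i) (hτmem _ _)) hE
    · rw [hfin, card_univ, Fintype.card_fin]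
      exact Nat.mul_le_mul_right _ hr
  · ext1 x
    have hx : ∀ f, bilinSlice p q f (shift z fun i => x ((Equiv.swap p q).symm i)) =
        bilinSlice p q f (shift z x) := fun f => bilinSlice_congr f fun i hp hq => by
      ext1 t
      simp [shift, Equiv.swap_apply_of_ne_of_ne hp hq]
    have e : permForm k (Equiv.swap p q) β x =
        φ (sqfreeCoeff R (truncInv (D x ^ 2) * W x (x q) (x p))) := by
      simp only [permForm, β, D, W, c, M, s, τ, hx]
      simp
    rw [Pi.add_apply, e, ← map_add φ, ← map_add, ← mul_add, ← hW,
      sqfreeCoeff_truncInv_mul (hD20 x)]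
    exact ((congr_arg φ (sqfreeCoeff_bilinSlice_shift hpq hσadd z x)).trans (hφ _)).symm

end SplitForms

theorem ProductForm.splitForm {k : ℕ} {V : Type*} [AddCommGroup V] (p q : Fin k)
    {h : (Fin k → V) → ZMod 2} (H : ProductForm h) :
    SplitForm p q {J | J ≠ ∅ ∧ p ∉ J ∧ q ∉ J} h := by
  obtain ⟨J, f, g, hJ, hJ', hf, hg, rfl⟩ := H
  by_cases hp : p ∈ J
  · refine ⟨Jᶜ, g, f, by simpa using hp, ?_, by simpa using hg, hf, mul_comm _ _⟩
    by_cases hq : q ∈ Jᶜ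
    · exact Or.inl hq
    · exact Or.inr (by simp_all)
  · refine ⟨J, f, g, hp, ?_, hf, hg, rfl⟩
    by_cases hq : q ∈ J
    · exact Or.inl hq
    · exact Or.inr (by simp_all)

section PartitionRank

variable {k : ℕ} {V : Type*} [AddCommGroup V] [Module (ZMod 2) V]

theorem sumOf_productForm_of_prankDecompOn {m : ℕ} {f : (Fin k → V) → ZMod 2}
    (h : PrankDecompOn k univ m f) : SumOf ProductForm m f := by
  obtain ⟨I, β, γ, -, hI, hI', hβ, hγ, hf⟩ := h
  have e : f = ∑ i, γ i * β i := by
    ext1 x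
    simp [hf, Finset.sum_apply, mul_comm]
  rw [e]
  refine (SumOf.sum (P := ProductForm) univ fun i _ => SumOf.single
    ⟨I i, γ i, β i, hI i, hI' i, ?_, hβ i, rfl⟩).mono (fun _ => id) (by simp)
  rw [compl_eq_univ_sdiff]
  exact hγ i

theorem exists_prankDecompOn_of_sumOf {N : ℕ} {f : (Fin k → V) → ZMod 2}
    (h : SumOf ProductForm N f) : ∃ m ≤ N, PrankDecompOn k univ m f := by
  obtain ⟨l, hl, hP, rfl⟩ := h
  refine ⟨l.length, hl, ?_⟩
  choose J f g hJ hJ' hf hg e using fun i : Fin l.length => hP l[i] (List.getElem_mem _)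
  refine ⟨J, g, f, fun _ => subset_univ _, hJ, hJ', hg, fun i => ?_, fun x => ?_⟩
  · rw [← compl_eq_univ_sdiff]
    exact hf i
  · rw [← Fin.sum_univ_getElem, Finset.sum_apply]
    refine sum_congr rfl fun i _ => ?_
    have := congr_fun (e i) x
    rw [Pi.mul_apply, mul_comm] at this
    exact this

theorem prank_le_of_sumOf {N : ℕ} {f : (Fin k → V) → ZMod 2} (h : SumOf ProductForm N f) :
    prank k f ≤ N := by
  obtain ⟨m, hm, hd⟩ := exists_prankDecompOn_of_sumOf h
  exact (Nat.sInf_le hd).trans hm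

/-- Over `𝔽₂ⁿ` every multilinear form in at least two variables is a sum of products. -/
theorem exists_sumOf_productForm {n : ℕ} {p q : Fin k} (hpq : p ≠ q)
    {f : (Fin k → Fin n → ZMod 2) → ZMod 2} (hf : AdditiveOn univ f) :
    SumOf ProductForm n f := by
  have e : f = ∑ t : Fin n, (fun x => f (({p} : Finset (Fin k)).piecewise
      (fun _ => Pi.single t 1) x)) * fun x => x p t := by
    ext1 x
    let F := AddMonoidHom.mk' (fun u => f (Function.update x p u)) (hf.2 p (mem_univ p) x)
    have h1 : x p = ∑ t, x p t • (Pi.single t 1 : Fin n → ZMod 2) := by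
      ext t
      simp [Finset.sum_apply, Pi.single_apply]
    have h2 : f x = F (x p) := by simp [F]
    rw [h2, h1, map_sum, Finset.sum_apply]
    refine sum_congr rfl fun t _ => ?_
    rw [ZMod.map_smul, smul_eq_mul, mul_comm]
    simp [F, piecewise_singleton]
  rw [e]
  refine (SumOf.sum (P := ProductForm) univ fun t _ => SumOf.single
    ⟨{p}, _, _, ?_, ?_, ?_, ?_, rfl⟩).mono (fun _ => id) (by simp)
  · simp
  · intro h
    have : q ∈ ({p} : Finset (Fin k)) := h ▸ mem_univ q
    exact hpq (mem_singleton.1 this).symm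
  · rw [compl_eq_univ_sdiff]
    exact hf.piecewise {p} _
  · exact AdditiveOn.apply (Pi.evalAddMonoidHom (fun _ : Fin n => ZMod 2) t) p

theorem sumOf_productForm_of_prank_le {n r : ℕ} {p q : Fin k} (hpq : p ≠ q)
    {f : (Fin k → Fin n → ZMod 2) → ZMod 2} (hf : AdditiveOn univ f) (h : prank k f ≤ r) :
    SumOf ProductForm r f := by
  have hne : {m | PrankDecompOn k univ m f}.Nonempty := by
    obtain ⟨m, -, hm⟩ := exists_prankDecompOn_of_sumOf (exists_sumOf_productForm hpq hf)
    exact ⟨m, hm⟩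
  exact (sumOf_productForm_of_prankDecompOn (Nat.sInf_mem hne)).mono (fun _ => id) h

theorem monotone_four_pow : Monotone fun N : ℕ => 4 ^ N :=
  fun _ _ h => Nat.pow_le_pow_right (by norm_num) h

theorem two_pow_mul_le_iterate (s N : ℕ) : 2 ^ s * N ≤ (4 ^ ·)^[s] N := by
  induction s with
  | zero => simp
  | succ s ih =>
    rw [Function.iterate_succ_apply', pow_succ', mul_assoc]
    exact (two_mul_le_four_pow _).trans (monotone_four_pow ih)

theorem self_mul_add_two_le (N : ℕ) : N * (N + 2) ≤ 4 ^ N := by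
  have h1 : N + 1 ≤ 2 ^ N := Nat.lt_two_pow_self
  calc N * (N + 2) ≤ (N + 1) * (N + 1) := by ring_nf; omega
    _ ≤ 2 ^ N * 2 ^ N := Nat.mul_le_mul h1 h1
    _ = 4 ^ N := (mul_pow 2 2 N).symm

theorem add_mul_le_iterate (k N : ℕ) : N + N * (2 ^ k * (N + 2)) ≤ (4 ^ ·)^[k + 2] N := by
  have h1 : N * (2 ^ k * (N + 2)) ≤ (4 ^ ·)^[k + 1] N := by
    rw [mul_left_comm, Function.iterate_succ_apply]
    exact (Nat.mul_le_mul_left _ (self_mul_add_two_le N)).trans (two_pow_mul_le_iterate k _)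
  have h2 := le_iterate_four_pow (k + 1) N
  rw [Function.iterate_succ_apply']
  exact (by omega : _ ≤ 2 * (4 ^ ·)^[k + 1] N).trans (two_mul_le_four_pow _)

theorem iterate_four_pow_le_iterate_exp (s N : ℕ) :
    (((4 ^ ·)^[s] N : ℕ) : ℝ) ≤ Real.exp^[2 * s] N := by
  induction s with
  | zero => simp
  | succ s ih =>
    rw [Nat.mul_succ, Function.iterate_succ_apply', Function.iterate_succ_apply',
      Function.iterate_succ_apply']
    set y := Real.exp^[2 * s] (N : ℝ)
    set a := (4 ^ ·)^[s] N
    have h4 : (4 : ℝ) ≤ Real.exp 2 := by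
      have h : (2 : ℝ) ≤ Real.exp 1 := by linarith [Real.add_one_le_exp (1 : ℝ)]
      have e : Real.exp 2 = Real.exp 1 * Real.exp 1 := by rw [← Real.exp_add]; norm_num
      nlinarith
    have h2 : 2 * (a : ℝ) ≤ Real.exp a := Real.two_mul_le_exp
    calc ((4 ^ a : ℕ) : ℝ) = 4 ^ a := by push_cast; rfl
      _ ≤ Real.exp 2 ^ a := by gcongr
      _ = Real.exp (2 * a) := by rw [← Real.exp_nat_mul, mul_comm]
      _ ≤ Real.exp (Real.exp y) := Real.exp_le_exp.2 (h2.trans (Real.exp_le_exp.2 ih))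

end PartitionRank

/-- A multilinear form with symmetrization of partition rank at most `r` has the same symmetrization
as a form of partition rank bounded in terms of `r`. -/
theorem exists_symmetrizable (k : ℕ) (p q : Fin k) (hpq : p ≠ q) :
    ∃ s : ℕ, ∀ (n r : ℕ) (α : (Fin k → Fin n → ZMod 2) → ZMod 2), AdditiveOn univ α →
      prank k (α + permForm k (Equiv.swap p q) α) ≤ r →
      Symmetrizable p q ((4 ^ ·)^[s] r) (α + permForm k (Equiv.swap p q) α) := by
  let 𝓤 : Finset (Finset (Fin k)) := {J | J ≠ ∅ ∧ p ∉ J ∧ q ∉ J}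
  refine ⟨k + 2 + 2 * 𝓤.card, fun n r α hα hr => ?_⟩
  set σ := α + permForm k (Equiv.swap p q) α with hσ
  have hsum := (sumOf_productForm_of_prank_le hpq (hα.add (hα.perm _)) hr).mono
    (fun _ H => ProductForm.splitForm p q H) le_rfl
  obtain ⟨σ', h1, h2, h3⟩ := eliminate_unsplit (p := p) (q := q) _ 𝓤 rfl (by simp [𝓤])
    (fun J hJ L hJL hp hq => by
      simp only [𝓤, mem_filter, mem_univ, true_and] at hJ ⊢
      exact ⟨fun h => hJ.1 (subset_empty.1 (h ▸ hJL)), hp, hq⟩) r σ ⟨α, hα, hσ⟩ hsum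
  have h4 := h2.add (symmetrizable_of_splitForm hpq h1 h3)
  rw [add_assoc, zmod_two_fun_add_self, add_zero] at h4
  rw [Function.iterate_add_apply]
  exact h4.mono (add_mul_le_iterate k _)

/-- **Theorem 5 (symmetrization in the first two variables).**
For every `k ≥ 2` there are constants `C ≥ 1` and `t ∈ ℕ` such that: if a multilinear
form `α : G^k → 𝔽₂` satisfies `prank(α + α∘(1 2)) ≤ r`, then there is a multilinear form
`α'` symmetric in its first two variables with `prank(α + α') ≤ exp^{(t)}(C·r)`. -/
theorem statement2 (k : ℕ) (hk : 2 ≤ k) :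
    ∃ (C : ℝ) (t : ℕ), 1 ≤ C ∧
      ∀ (n : ℕ) (α : (Fin k → (Fin n → ZMod 2)) → ZMod 2), IsMultilinear k α →
        ∀ r : ℕ,
          prank k (α + permForm k (Equiv.swap ⟨0, by omega⟩ ⟨1, by omega⟩) α) ≤ r →
          ∃ α' : (Fin k → (Fin n → ZMod 2)) → ZMod 2,
            IsMultilinear k α' ∧ SymmetricInFirst k 2 α' ∧
            (prank k (α + α') : ℝ) ≤ Real.exp^[t] (C * r) := by
  have h0 : 0 < k := by omega
  have h1 : 1 < k := by omega
  have hpq : (⟨0, h0⟩ : Fin k) ≠ ⟨1, h1⟩ := by simp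
  obtain ⟨s, hs⟩ := exists_symmetrizable k _ _ hpq
  refine ⟨1, 2 * s, le_rfl, fun n α hα r hr => ?_⟩
  obtain ⟨β, hβ, hαβ⟩ := hs n r α hα hr
  have hsymm : permForm k (Equiv.swap ⟨0, h0⟩ ⟨1, h1⟩) (α + β) = α + β := by
    rw [permForm_add, ← sub_eq_zero]
    have h2 := zmod_two_fun_add_self (β + permForm k (Equiv.swap ⟨0, h0⟩ ⟨1, h1⟩) β)
    nth_rewrite 1 [← hαβ] at h2
    have hneg : ∀ f : (Fin k → Fin n → ZMod 2) → ZMod 2, -f = f := fun f =>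
      neg_eq_of_add_eq_zero_left (zmod_two_fun_add_self f)
    rw [sub_eq_add_neg, hneg, ← h2]
    abel
  refine ⟨α + β, AdditiveOn.add (S := univ) hα hβ.additiveOn, fun i j hi hj => ?_, ?_⟩
  · have hi' : i = ⟨0, h0⟩ ∨ i = ⟨1, h1⟩ := by simp only [Fin.ext_iff]; omega
    have hj' : j = ⟨0, h0⟩ ∨ j = ⟨1, h1⟩ := by simp only [Fin.ext_iff]; omega
    rcases hi' with rfl | rfl <;> rcases hj' with rfl | rfl
    · rw [Equiv.swap_self]; rfl
    · exact hsymm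
    · rw [Equiv.swap_comm]; exact hsymm
    · rw [Equiv.swap_self]; rfl
  · rw [← add_assoc, zmod_two_fun_add_self, zero_add, one_mul]
    exact (Nat.cast_le.2 (prank_le_of_sumOf hβ)).trans (iterate_four_pow_le_iterate_exp s r)
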